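/- arXiv:1203.0726 — 4 statements merged into one kernel-verified Lean document; each statement's English description precedes it below -/
import Mathlib

section
/- Let K be an infinite field of characteristic p, and let f_1, ..., f_r ∈ K[T,X] be pairwise non-associate absolutely irreducible polynomials such that for each i, writing d_i for the total degree of f_i, one has d_i ≥ 2, p does not divide d_i(d_i − 1), and the projective plane curve defined by the homogenization of f_i is smooth. Then there exist α, β ∈ K with the following property: for each 1 ≤ i ≤ r, the polynomial g_i(U, T) := U^{d_i} · f_i(T, (α + T + β·U)/U) lies in K[U, T], and, regarded as a polynomial in T over the rational function field K̄(U) (where K̄ is an algebraic closure of K), its splitting field has Galois group over K̄(U) isomorphic to the symmetric group S_{d_i}. -/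
open MvPolynomial

/-- `f ∈ K[T,X]` is absolutely irreducible: it is irreducible over an algebraic
closure of `K`. -/
def AbsolutelyIrreducible {K : Type*} [Field K] (f : MvPolynomial (Fin 2) K) : Prop :=
  Irreducible (MvPolynomial.map (algebraMap K (AlgebraicClosure K)) f)

/-- `F ∈ K[X₀,X₁,X₂]` is the degree-`d` homogenization of `f ∈ K[T,X]`
(so `F` is homogeneous of degree `d` with `F(1,T,X) = f(T,X)`) and the projective
plane curve `F = 0` is smooth: `F` and its three partial derivatives have no common
zero `≠ (0,0,0)` with coordinates in an algebraic closure of `K`. -/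
def IsSmoothHomogenization {K : Type*} [Field K] (F : MvPolynomial (Fin 3) K)
    (f : MvPolynomial (Fin 2) K) (d : ℕ) : Prop :=
  F.IsHomogeneous d ∧
  MvPolynomial.aeval ![1, MvPolynomial.X 0, MvPolynomial.X 1] F = f ∧
  ∀ x : Fin 3 → AlgebraicClosure K, x ≠ 0 →
    MvPolynomial.eval x (F.map (algebraMap K (AlgebraicClosure K))) = 0 →
    ∃ j : Fin 3, MvPolynomial.eval x ((MvPolynomial.pderiv j F).map
      (algebraMap K (AlgebraicClosure K))) ≠ 0

/-- `g(U,T) = U^d · f(T, (α + T + β·U)/U)`, regarded as a polynomial in `T` over the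
rational function field `K̄(U) = Frac(K̄[U])`, where `K̄` is an algebraic closure of `K`
(the substitution `X := (α + T + β·U)/U` applied to `f ∈ K[T,X]` with the denominator
cleared; variable `0` of `f` is `T` and variable `1` is `X`). -/
noncomputable def lineSubU {K : Type*} [Field K] (f : MvPolynomial (Fin 2) K) (d : ℕ)
    (α β : K) : Polynomial (FractionRing (Polynomial (AlgebraicClosure K))) :=
  letI Kb := AlgebraicClosure K
  letI Fq := FractionRing (Polynomial Kb)
  letI u : Fq := algebraMap (Polynomial Kb) Fq Polynomial.X
  Polynomial.C (u ^ d) *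
    MvPolynomial.aeval
      ![Polynomial.X,
        Polynomial.C ((algebraMap Kb Fq (algebraMap K Kb α)) * u⁻¹ +
            algebraMap Kb Fq (algebraMap K Kb β)) +
          Polynomial.C u⁻¹ * Polynomial.X]
      (f.map (algebraMap K Kb))

lemma aux_finite_spec {A : Type*} [CommRing A] [IsNoetherianRing A] (h : ringKrullDim A ≤ 0) :
    Finite (PrimeSpectrum A) := by
  have h6 : Ring.KrullDimLE 0 A := (Order.krullDimLE_iff 0 _).2 h
  have h7 : IsArtinianRing A := IsNoetherianRing.isArtinianRing_of_krullDimLE_zero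
  infer_instance

lemma aux_finite_zeros {L : Type*} [Field L] (f G : MvPolynomial (Fin 2) L)
    (hf : Irreducible f) (h : ¬ f ∣ G) :
    {p : Fin 2 → L | eval p f = 0 ∧ eval p G = 0}.Finite := by
  have hprime : Prime f := hf.prime
  have hI : (Ideal.span {f}).IsPrime := (Ideal.span_singleton_prime hf.ne_zero).2 hprime
  let A := MvPolynomial (Fin 2) L ⧸ Ideal.span {f}
  let g : A := Ideal.Quotient.mk _ G
  have hg : g ≠ 0 := by
    intro h0
    exact h (Ideal.mem_span_singleton.1 (Ideal.Quotient.eq_zero_iff_mem.1 h0))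
  let A' := A ⧸ Ideal.span {g}
  have h2 : ringKrullDim (MvPolynomial (Fin 2) L) = 2 := by
    rw [MvPolynomial.ringKrullDim_of_isNoetherianRing]; simp
  have h3 : ringKrullDim A + 1 ≤ 2 := by
    rw [← h2]
    exact ringKrullDim_quotient_succ_le_of_nonZeroDivisor
      (mem_nonZeroDivisors_of_ne_zero hf.ne_zero)
  have h4 : ringKrullDim A' + 1 ≤ ringKrullDim A :=
    ringKrullDim_quotient_succ_le_of_nonZeroDivisor (mem_nonZeroDivisors_of_ne_zero hg)
  have h5 : ringKrullDim A' ≤ 0 := by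
    have h6 : (ringKrullDim A' + 1) + 1 ≤ 2 := le_trans (by gcongr) h3
    generalize ringKrullDim A' = x at h6
    induction x using WithBot.recBotCoe with
    | bot => exact bot_le
    | coe x =>
      induction x using ENat.recTopCoe with
      | top => exact absurd h6 (by decide)
      | coe n =>
        have h7 : (((n + 1 + 1 : ℕ) : ℕ∞) : WithBot ℕ∞) ≤ ((2 : ℕ) : ℕ∞) := by
          push_cast; exact h6
        have : n + 1 + 1 ≤ 2 := by
          rw [WithBot.coe_le_coe, Nat.cast_le] at h7; exact h7
        have : n = 0 := by omega
        subst this; exact le_rfl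
  have h8 : Finite (PrimeSpectrum A') :=
    @aux_finite_spec A' (Ideal.Quotient.commRing _) inferInstance h5
  let S := {p : Fin 2 → L | eval p f = 0 ∧ eval p G = 0}
  let φ : S → (A' →+* L) := fun p =>
    Ideal.Quotient.lift _ (Ideal.Quotient.lift _ (eval p.1) (by
      intro a ha
      obtain ⟨b, rfl⟩ := Ideal.mem_span_singleton.1 ha
      rw [map_mul, p.2.1, zero_mul])) (by
      intro a ha
      obtain ⟨b, rfl⟩ := Ideal.mem_span_singleton.1 ha
      rw [map_mul]
      have : (Ideal.Quotient.lift (Ideal.span {f}) (eval p.1) (by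
        intro a ha
        obtain ⟨b, rfl⟩ := Ideal.mem_span_singleton.1 ha
        rw [map_mul, p.2.1, zero_mul])) g = 0 := by
        rw [Ideal.Quotient.lift_mk]; exact p.2.2
      rw [this, zero_mul])
  have hφ : ∀ p : S, ∀ q, φ p (Ideal.Quotient.mk _ (Ideal.Quotient.mk _ q)) = eval p.1 q := by
    intro p q
    rfl
  let ψ : S → PrimeSpectrum A' := fun p => ⟨RingHom.ker (φ p), RingHom.ker_isPrime _⟩
  have hinj : Function.Injective ψ := by
    intro p q hpq
    have hk : RingHom.ker (φ p) = RingHom.ker (φ q) := congrArg PrimeSpectrum.asIdeal hpq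
    apply Subtype.ext
    funext i
    have : (Ideal.Quotient.mk _ (Ideal.Quotient.mk _ (X i - C (p.1 i))) : A') ∈ RingHom.ker (φ p) := by
      rw [RingHom.mem_ker, hφ]; simp
    rw [hk, RingHom.mem_ker, hφ] at this
    simp [sub_eq_zero] at this
    exact this.symm
  exact Finite.of_injective ψ hinj

lemma aux_exists_val {L κ : Type*} [Field L] [IsAlgClosed L] [Field κ] [Algebra L κ] (y : κ)
    (hy : y ∉ Set.range (algebraMap L κ)) :
    ∃ V : ValuationSubring κ, (∀ a : L, algebraMap L κ a ∈ V) ∧ y ∉ V := by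
  let R : Subring κ := (algebraMap L κ).range
  have : IsIntegrallyClosedIn R κ := by
    rw [isIntegrallyClosedIn_iff]
    refine ⟨Subtype.val_injective, ?_⟩
    intro x hx
    let e : L →+* R := (algebraMap L κ).rangeRestrict
    have h1 : IsIntegral L x := by
      obtain ⟨P, hP, hx⟩ := hx
      have hs : Function.Surjective e := (algebraMap L κ).rangeRestrict_surjective
      obtain ⟨P', hP', _, hm⟩ := Polynomial.lifts_and_natDegree_eq_and_monic
        (f := e) ((Polynomial.lifts_iff_coeff_lifts _).2 fun n => (hs (P.coeff n))) hP
      refine ⟨P', hm, ?_⟩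
      rw [← hP', Polynomial.eval₂_map] at hx
      exact hx
    have h2 := IsAlgClosed.algebraMap_bijective_of_isIntegral (k := L) (K := integralClosure L κ)
    obtain ⟨a, ha⟩ := h2.2 ⟨x, h1⟩
    refine ⟨⟨algebraMap L κ a, a, rfl⟩, ?_⟩
    exact congrArg Subtype.val ha
  obtain ⟨V, h1, h2⟩ := Subring.exists_le_valuationSubring_of_isIntegrallyClosedIn (R := R) (x := y)
    (by rintro ⟨a, ha⟩; exact hy ⟨a, ha⟩)
  exact ⟨V, fun a => h1 ⟨a, rfl⟩, h2⟩

lemma aux_pderiv_comm {L σ : Type*} [CommRing L] (i j : σ) (F : MvPolynomial σ L) :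
    pderiv i (pderiv j F) = pderiv j (pderiv i F) := by
  classical
  induction F using MvPolynomial.induction_on with
  | C a => simp
  | add p q hp hq => simp [hp, hq]
  | mul_X p k hp =>
    simp only [Derivation.leibniz, map_add, smul_eq_mul, pderiv_X, hp]
    have h : ∀ (a b : σ) , pderiv a (Pi.single (M := fun _ : σ => MvPolynomial σ L) b 1 k) = 0 := by
      intro a b
      by_cases hb : k = b
      · subst hb; simp
      · simp [hb]
    simp only [h]
    ring

lemma aux_scale {L R σ : Type*} [CommRing L] [CommRing R] [Algebra L R] {F : MvPolynomial σ L} {d : ℕ}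
    (hF : F.IsHomogeneous d) (c : R) (v : σ → R) :
    aeval (fun i => c * v i) F = c ^ d * aeval v F := by
  rw [aeval_def, aeval_def, eval₂_eq, eval₂_eq, Finset.mul_sum]
  refine Finset.sum_congr rfl fun m hm => ?_
  have hd := hF (mem_support_iff.1 hm)
  simp only [mul_pow, Finset.prod_mul_distrib]
  have : ∏ i ∈ m.support, c ^ m i = c ^ d := by
    rw [Finset.prod_pow_eq_pow_sum, ← hd, Finsupp.weight_apply]
    simp [Finsupp.sum]
  rw [this]; ring

lemma aux_euler {L R : Type*} [CommRing L] [CommRing R] [Algebra L R]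
    {F : MvPolynomial (Fin 3) L} {d : ℕ}
    (hF : F.IsHomogeneous d) (v : Fin 3 → R) :
    v 0 * aeval v (pderiv 0 F) + v 1 * aeval v (pderiv 1 F) + v 2 * aeval v (pderiv 2 F)
      = (d : R) * aeval v F := by
  have h := congrArg (aeval v) hF.sum_X_mul_pderiv
  simpa [Fin.sum_univ_three] using h

lemma aux_null {L : Type*} [Field L] [IsAlgClosed L] {F : MvPolynomial (Fin 3) L}
    (hsm : ∀ x : Fin 3 → L, x ≠ 0 → eval x F = 0 → ∃ j, eval x (pderiv j F) ≠ 0) (k : Fin 3) :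
    ∃ n : ℕ, ∃ a b0 b1 b2 : MvPolynomial (Fin 3) L,
      X k ^ n = a * F + b0 * pderiv 0 F ^ 2 + b1 * pderiv 1 F ^ 2 + b2 * pderiv 2 F ^ 2 := by
  let I : Ideal (MvPolynomial (Fin 3) L) :=
    Ideal.span {F, pderiv 0 F ^ 2, pderiv 1 F ^ 2, pderiv 2 F ^ 2}
  have h : (X k : MvPolynomial (Fin 3) L) ∈ I.radical := by
    rw [← vanishingIdeal_zeroLocus_eq_radical (K := L), mem_vanishingIdeal_iff]
    intro x hx
    rw [mem_zeroLocus_iff] at hx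
    have e : ∀ p : MvPolynomial (Fin 3) L, aeval x p = eval x p := fun p => by simp [aeval_eq_eval]
    simp only [e] at hx ⊢
    by_cases h0 : x = 0
    · simp [h0]
    · obtain ⟨j, hj⟩ := hsm x h0 (hx F (Ideal.subset_span (by simp)))
      exfalso; apply hj
      have : eval x (pderiv j F ^ 2) = 0 := by
        apply hx
        apply Ideal.subset_span
        fin_cases j <;> simp
      rw [map_pow] at this
      exact pow_eq_zero_iff (two_ne_zero) |>.1 this
  obtain ⟨n, hn⟩ := h
  refine ⟨n, ?_⟩
  rw [Ideal.mem_span_insert] at hn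
  obtain ⟨a, z, hz, h1⟩ := hn
  rw [Ideal.mem_span_insert] at hz
  obtain ⟨b0, z, hz, rfl⟩ := hz
  rw [Ideal.mem_span_pair] at hz
  obtain ⟨b1, b2, rfl⟩ := hz
  exact ⟨a, b0, b1, b2, by rw [h1]; ring⟩

/-- linear algebra behind the flex lemma -/
lemma aux_linalg {κ : Type*} [Field κ] (h2 : (2 : κ) ≠ 0) (e v1 v2 p0 p1 p2 m00 m01 m02 m11 m12 m22 : κ)
    (hp : p0 + v1 * p1 + v2 * p2 = 0)
    (e0 : m00 + v1 * m01 + v2 * m02 = e * p0)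
    (e1 : m01 + v1 * m11 + v2 * m12 = e * p1)
    (e2 : m02 + v1 * m12 + v2 * m22 = e * p2)
    (h : p2 ^ 2 * m11 - 2 * p1 * p2 * m12 + p1 ^ 2 * m22 = 0)
    (hne : p1 ≠ 0 ∨ p2 ≠ 0) :
    ∃ a0 a1 a2 : κ, m00 = 2 * p0 * a0 ∧ m11 = 2 * p1 * a1 ∧ m22 = 2 * p2 * a2 ∧
      m01 = p0 * a1 + p1 * a0 ∧ m02 = p0 * a2 + p2 * a0 ∧ m12 = p1 * a2 + p2 * a1 := by
  have key : ∃ a1 a2 : κ, m11 = 2 * p1 * a1 ∧ m22 = 2 * p2 * a2 ∧ m12 = p1 * a2 + p2 * a1 := by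
    rcases hne with hne | hne
    · refine ⟨m11 / (2 * p1), (m12 - m11 / (2 * p1) * p2) / p1, ?_, ?_, ?_⟩
      · field_simp
      · field_simp
        linear_combination h
      · field_simp; ring
    · refine ⟨(m12 - m22 / (2 * p2) * p1) / p2, m22 / (2 * p2), ?_, ?_, ?_⟩
      · field_simp
        linear_combination h
      · field_simp
      · field_simp; ring
  obtain ⟨a1, a2, k11, k22, k12⟩ := key
  refine ⟨e - v1 * a1 - v2 * a2, a1, a2, ?_, k11, k22, ?_, ?_, k12⟩
  · have h01 : m01 = e * p1 - v1 * m11 - v2 * m12 := by linear_combination e1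
    have h02 : m02 = e * p2 - v1 * m12 - v2 * m22 := by linear_combination e2
    have h00 : m00 = e * p0 - v1 * m01 - v2 * m02 := by linear_combination e0
    have h0 : p0 = - v1 * p1 - v2 * p2 := by linear_combination hp
    rw [h00, h01, h02, k11, k12, k22, h0]; ring
  · have h0 : p0 = - v1 * p1 - v2 * p2 := by linear_combination hp
    have h01 : m01 = e * p1 - v1 * m11 - v2 * m12 := by linear_combination e1
    rw [h01, k11, k12, h0]; ring
  · have h0 : p0 = - v1 * p1 - v2 * p2 := by linear_combination hp
    have h02 : m02 = e * p2 - v1 * m12 - v2 * m22 := by linear_combination e2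
    rw [h02, k22, k12, h0]; ring

/-- The polynomial whose vanishing detects flexes. -/
noncomputable def flexPoly {L : Type*} [CommRing L] (F : MvPolynomial (Fin 3) L) :
    MvPolynomial (Fin 3) L :=
  pderiv 2 F ^ 2 * pderiv 1 (pderiv 1 F) - 2 * pderiv 1 F * pderiv 2 F * pderiv 1 (pderiv 2 F)
    + pderiv 1 F ^ 2 * pderiv 2 (pderiv 2 F)

lemma aux_mem_val {L κ σ : Type*} [Field L] [Field κ] [Algebra L κ] (V : ValuationSubring κ)
    (hV : ∀ a : L, algebraMap L κ a ∈ V) (w : σ → κ) (hw : ∀ i, w i ∈ V) (G : MvPolynomial σ L) :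
    aeval w G ∈ V := by
  induction G using MvPolynomial.induction_on with
  | C a => simpa using hV a
  | add p q hp hq => rw [map_add]; exact add_mem hp hq
  | mul_X p k hp => rw [map_mul, aeval_X]; exact mul_mem hp (hw k)

lemma aux_max_coord {κ : Type*} [Field κ] (V : ValuationSubring κ) (v : Fin 3 → κ) (hv : v 0 = 1) :
    ∃ l, v l ≠ 0 ∧ ∀ k, (v l)⁻¹ * v k ∈ V := by
  obtain ⟨l, hl⟩ := Finite.exists_max (fun i => V.valuation (v i))
  have h0 : v l ≠ 0 := by
    intro h
    have := hl 0
    simp [h, hv] at this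
  refine ⟨l, h0, fun k => ?_⟩
  rw [← ValuationSubring.valuation_le_one_iff, map_mul, map_inv₀]
  have : V.valuation (v l) ≠ 0 := by simpa using h0
  rw [inv_mul_le_one₀ (zero_lt_iff.2 this)]
  exact hl k

lemma aux_flex {L κ : Type*} [Field L] [IsAlgClosed L] [Field κ] [Algebra L κ]
    {F : MvPolynomial (Fin 3) L} {d : ℕ} (hd : 2 ≤ d)
    (h2 : (2 : L) ≠ 0) (hd1 : ((d - 1 : ℕ) : L) ≠ 0)
    (hF : F.IsHomogeneous d)
    (hsm : ∀ x : Fin 3 → L, x ≠ 0 → eval x F = 0 → ∃ j, eval x (pderiv j F) ≠ 0)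
    (v : Fin 3 → κ) (hv0 : v 0 = 1) (hFv : aeval v F = 0) (k : Fin 3)
    (hk : v k ∉ Set.range (algebraMap L κ)) :
    aeval v (flexPoly F) ≠ 0 := by
  intro hflex
  have h2' : (2 : κ) ≠ 0 := by
    have := (map_ne_zero (algebraMap L κ)).2 h2
    rwa [map_ofNat] at this
  have hd1' : ((d - 1 : ℕ) : κ) ≠ 0 := by
    have := (map_ne_zero (algebraMap L κ)).2 hd1
    rwa [map_natCast] at this
  have E := aux_euler hF v
  have E0 := aux_euler (hF.pderiv (i := 0)) v
  have E1 := aux_euler (hF.pderiv (i := 1)) v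
  have E2 := aux_euler (hF.pderiv (i := 2)) v
  rw [hFv, mul_zero, hv0, one_mul] at E
  rw [hv0, one_mul] at E0 E1 E2
  rw [aux_pderiv_comm 1 0, aux_pderiv_comm 2 0] at E0
  rw [aux_pderiv_comm 2 1] at E1
  -- not all derivatives vanish
  have hnz : ¬ (∀ i, aeval v (pderiv i F) = 0) := by
    intro hall
    obtain ⟨n, a, b0, b1, b2, hn⟩ := aux_null hsm 0
    have := congrArg (aeval v) hn
    simp [hall, hFv, hv0] at this
  have hne : aeval v (pderiv 1 F) ≠ 0 ∨ aeval v (pderiv 2 F) ≠ 0 := by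
    by_contra hcon
    push Not at hcon
    apply hnz
    intro i
    fin_cases i
    · simpa [hcon.1, hcon.2] using E
    · exact hcon.1
    · exact hcon.2
  have hfl : aeval v (pderiv 2 F) ^ 2 * aeval v (pderiv 1 (pderiv 1 F))
      - 2 * aeval v (pderiv 1 F) * aeval v (pderiv 2 F) * aeval v (pderiv 1 (pderiv 2 F))
      + aeval v (pderiv 1 F) ^ 2 * aeval v (pderiv 2 (pderiv 2 F)) = 0 := by
    simpa [flexPoly] using hflex
  obtain ⟨a0, a1, a2, k00, k11, k22, k01, k02, k12⟩ :=
    aux_linalg h2' _ (v 1) (v 2) _ _ _ _ _ _ _ _ _ E E0 E1 E2 hfl hne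
  let a : Fin 3 → κ := ![a0, a1, a2]
  have hM : ∀ i j, aeval v (pderiv i (pderiv j F)) =
      aeval v (pderiv i F) * a j + aeval v (pderiv j F) * a i := by
    intro i j
    fin_cases i <;> fin_cases j
    · simp only [a]; simp; rw [k00]; ring
    · simp only [a]; simp; exact k01
    · simp only [a]; simp; exact k02
    · simp only [a]; simp; rw [aux_pderiv_comm, k01]; ring
    · simp only [a]; simp; rw [k11]; ring
    · simp only [a]; simp; exact k12
    · simp only [a]; simp; rw [aux_pderiv_comm, k02]; ring
    · simp only [a]; simp; rw [aux_pderiv_comm, k12]; ring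
    · simp only [a]; simp; rw [k22]; ring
  have hreg : ∀ V : ValuationSubring κ, (∀ b : L, algebraMap L κ b ∈ V) →
      ∃ l, (∀ j, v l * a j ∈ V) ∧ v l ≠ 0 ∧ ∀ k, (v l)⁻¹ * v k ∈ V := by
    intro V hV
    obtain ⟨l, hl0, hl⟩ := aux_max_coord V v hv0
    refine ⟨l, fun j => ?_, hl0, hl⟩
    set w : Fin 3 → κ := fun k => (v l)⁻¹ * v k with hw
    have hvw : v = fun k => v l * w k := by
      funext k; simp [hw, hl0]
    have hFw : aeval w F = 0 := by
      rw [hw, aux_scale hF, hFv, mul_zero]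
    obtain ⟨n, A, b0, b1, b2, hn⟩ := aux_null hsm l
    have hn' := congrArg (aeval w) hn
    have hwl : w l = 1 := by simp [hw, hl0]
    simp only [map_add, map_mul, map_pow, aeval_X, hwl, one_pow, hFw, mul_zero, zero_add] at hn'
    have hmem := aux_mem_val V hV w hl
    have hi : ∀ i, v l * a j * aeval w (pderiv i F) ^ 2 ∈ V := by
      intro i
      have hPi : ∀ i, aeval v (pderiv i F) = v l ^ (d - 1) * aeval w (pderiv i F) := by
        intro i
        conv_lhs => rw [hvw]
        exact aux_scale hF.pderiv _ _
      have hMi : ∀ i j, aeval v (pderiv i (pderiv j F)) =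
          v l ^ (d - 1 - 1) * aeval w (pderiv i (pderiv j F)) := by
        intro i j
        conv_lhs => rw [hvw]
        exact aux_scale hF.pderiv.pderiv _ _
      have h3 := hM i j
      have h4 := hM i i
      simp only [hPi, hMi] at h3 h4
      have h5 : v l * a j * aeval w (pderiv i F) ^ 2 =
          aeval w (pderiv i F) * aeval w (pderiv i (pderiv j F))
          - aeval w (pderiv j F) * aeval w (pderiv i (pderiv i F)) * (2 : κ)⁻¹ := by
        obtain ⟨e, he⟩ : ∃ e, d = e + 2 := ⟨d - 2, by omega⟩
        subst he
        simp only [Nat.add_succ_sub_one, Nat.add_sub_cancel, pow_succ] at h3 h4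
        have hne : v l ^ e ≠ 0 := pow_ne_zero _ hl0
        have h3' : aeval w (pderiv i (pderiv j F)) = v l * aeval w (pderiv i F) * a j
            + v l * aeval w (pderiv j F) * a i := by
          apply mul_left_cancel₀ hne; linear_combination h3
        have h4' : aeval w (pderiv i (pderiv i F)) = 2 * v l * aeval w (pderiv i F) * a i := by
          apply mul_left_cancel₀ hne; linear_combination h4
        rw [h3', h4']; field_simp; ring
      rw [h5]
      have h2V : (2 : κ)⁻¹ ∈ V := by
        have := hV (2⁻¹)
        rwa [map_inv₀, map_ofNat] at this
      exact sub_mem (mul_mem (hmem _) (hmem _)) (mul_mem (mul_mem (hmem _) (hmem _)) h2V)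
    have : v l * a j = aeval w b0 * (v l * a j * aeval w (pderiv 0 F) ^ 2)
        + aeval w b1 * (v l * a j * aeval w (pderiv 1 F) ^ 2)
        + aeval w b2 * (v l * a j * aeval w (pderiv 2 F) ^ 2) := by
      linear_combination (v l * a j) * hn'
    rw [this]
    exact add_mem (add_mem (mul_mem (hmem _) (hi _)) (mul_mem (hmem _) (hi _)))
      (mul_mem (hmem _) (hi _))
  have ha : ∀ j, a j ∈ Set.range (algebraMap L κ) := by
    intro j
    by_contra hj
    obtain ⟨V, hV, hjV⟩ := aux_exists_val (a j) hj
    obtain ⟨l, h1, h2, h3⟩ := hreg V hV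
    apply hjV
    have := mul_mem (h3 0) (h1 j)
    rw [hv0, mul_one, inv_mul_cancel_left₀ h2] at this
    exact this
  have ha0 : ∀ j, a j = 0 := by
    intro j
    by_contra hj
    obtain ⟨b, hb⟩ := ha j
    obtain ⟨V, hV, hkV⟩ := aux_exists_val (v k) hk
    obtain ⟨l, h1, h2, h3⟩ := hreg V hV
    apply hkV
    have h4 := mul_mem (mul_mem (h3 k) (h1 j)) (hV b⁻¹)
    rw [map_inv₀, hb] at h4
    have : (v l)⁻¹ * v k * (v l * a j) * (a j)⁻¹ = v k := by field_simp
    rwa [this] at h4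
  apply hnz
  have hM0 : ∀ i j, aeval v (pderiv i (pderiv j F)) = 0 := by
    intro i j; rw [hM, ha0, ha0]; ring
  intro i
  have E' := aux_euler (hF.pderiv (i := i)) v
  simp only [hM0, mul_zero, add_zero] at E'
  rcases mul_eq_zero.1 E'.symm with h | h
  · exact absurd h hd1'
  · exact h

lemma aux_exists_pderiv_ne {L σ : Type*} [Field L] [IsAlgClosed L] {H : MvPolynomial σ L}
    (hH : Irreducible H) : ∃ i, pderiv i H ≠ 0 := by
  classical
  by_contra! hcon
  have hm : ∀ m ∈ H.support, ∀ i, ((m i : ℕ) : L) = 0 := by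
    intro m hm i
    by_cases h0 : m i = 0
    · simp [h0]
    have h1 : m = (m - Finsupp.single i 1) + Finsupp.single i 1 := by
      ext j
      by_cases hj : j = i
      · subst hj; simp; omega
      · simp [Finsupp.single_eq_of_ne hj]
    have h2 := coeff_pderiv (i := i) H (m - Finsupp.single i 1)
    rw [hcon, ← h1, coeff_zero] at h2
    have h3 := (mul_eq_zero.1 h2.symm).resolve_left (mem_support_iff.1 hm)
    have h4 : m i = (m - Finsupp.single i 1 : σ →₀ ℕ) i + 1 := by simp; omega
    rw [h4]; push_cast; exact h3
  obtain ⟨q, hq⟩ := CharP.exists L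
  rcases CharP.char_is_prime_or_zero L q with hp | hp
  · have : Fact q.Prime := ⟨hp⟩
    have hdvd : ∀ m ∈ H.support, ∀ i, q ∣ m i := fun m h i =>
      (CharP.cast_eq_zero_iff L q _).1 (hm m h i)
    have hroot : ∀ c : L, ∃ b, b ^ q = c := fun c =>
      IsAlgClosed.exists_pow_nat_eq c hp.pos
    choose b hb using hroot
    have hpow : H = (∑ m ∈ H.support,
        monomial (m.mapRange (fun n => n / q) (by simp)) (b (coeff m H))) ^ q := by
      rw [sum_pow_char]
      conv_lhs => rw [H.as_sum]
      refine Finset.sum_congr rfl fun m h => ?_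
      rw [monomial_pow, hb]
      have e : q • m.mapRange (fun n => n / q) (by simp) = m := by
        refine Finsupp.ext fun i => ?_
        simp [Nat.mul_div_cancel' (hdvd m h i)]
      rw [e]
    rw [hpow] at hH
    exact not_irreducible_pow hp.ne_one hH
  · subst hp
    have : CharZero L := CharP.charP_to_charZero L
    have h0 : ∀ m ∈ H.support, m = 0 := by
      intro m h
      ext i
      exact_mod_cast hm m h i
    have : H = C (coeff 0 H) := by
      ext m
      rw [coeff_C]
      split_ifs with h
      · rw [h]
      · by_contra h'
        exact h (h0 m (mem_support_iff.2 h')).symm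
    by_cases hc : coeff 0 H = 0
    · rw [hc, C_0] at this; exact hH.ne_zero this
    · apply hH.not_isUnit
      rw [this]
      exact (isUnit_iff_ne_zero.2 hc).map C

open TrivSqZeroExt in
lemma aux_taylor {L κ : Type*} [Field L] [Field κ] [Algebra L κ] (v w : Fin 2 → κ)
    (G : MvPolynomial (Fin 2) L) :
    aeval (fun i => (inl (v i) + inr (w i) : DualNumber κ)) G =
      inl (aeval v G) + inr (w 0 * aeval v (pderiv 0 G) + w 1 * aeval v (pderiv 1 G)) := by
  induction G using MvPolynomial.induction_on with
  | C a => 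
    simp only [algHom_C, pderiv_C, map_zero, mul_zero, add_zero, inr_zero]
    rfl
  | add p q hp hq =>
    rw [map_add, hp, hq]
    ext <;> simp; ring
  | mul_X p k hp =>
    rw [map_mul, hp, aeval_X]
    fin_cases k
    · ext <;> simp [pderiv_X]; ring
    · ext <;> simp [pderiv_X]; ring

lemma aux_hat.{u} {L : Type u} [Field L] (a b : MvPolynomial (Fin 2) L) (H : MvPolynomial (Fin 2) L) :
    ∃ (G : MvPolynomial (Fin 2) L) (N : ℕ), ∀ (R : Type u) [CommRing R] [Algebra L R] (v : Fin 2 → R)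
      (i : R), aeval v a * i = 1 →
      aeval v G = aeval v a ^ N *
        aeval ![- (aeval v b * i), v 0 + v 1 * (aeval v b * i)] H := by
  induction H using MvPolynomial.induction_on with
  | C c => exact ⟨C c, 0, fun R _ _ v i h => by simp⟩
  | add p q hp hq =>
    obtain ⟨G1, N1, h1⟩ := hp
    obtain ⟨G2, N2, h2⟩ := hq
    refine ⟨a ^ N2 * G1 + a ^ N1 * G2, N1 + N2, fun R _ _ v i h => ?_⟩
    simp only [map_add, map_mul, map_pow, h1 R v i h, h2 R v i h]
    ring
  | mul_X p k hp =>
    obtain ⟨G1, N1, h1⟩ := hp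
    fin_cases k
    · refine ⟨G1 * (- b), N1 + 1, fun R _ _ v i h => ?_⟩
      simp only [map_mul, map_neg, h1 R v i h, aeval_X]
      simp only [Fin.zero_eta, Matrix.cons_val_zero]
      linear_combination (aeval v b * aeval v a ^ N1 *
        aeval ![- (aeval v b * i), v 0 + v 1 * (aeval v b * i)] p) * h
    · refine ⟨G1 * (X 0 * a + X 1 * b), N1 + 1, fun R _ _ v i h => ?_⟩
      simp only [map_mul, map_add, h1 R v i h, aeval_X]
      simp only [Fin.mk_one, Matrix.cons_val_one, Matrix.cons_val_zero]
      linear_combination (- v 1 * aeval v b * aeval v a ^ N1 *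
        aeval ![- (aeval v b * i), v 0 + v 1 * (aeval v b * i)] p) * h

lemma aux_generic.{u} {L : Type u} [Field L] {f : MvPolynomial (Fin 2) L} (hf : Irreducible f) :
    ∃ (κ : Type u) (_ : Field κ) (_ : Algebra L κ) (ξ : Fin 2 → κ),
      (∀ G : MvPolynomial (Fin 2) L, aeval ξ G = 0 ↔ f ∣ G) ∧
      Algebra.IsAlgebraic (Algebra.adjoin L (Set.range ξ)) κ := by
  have hI : (Ideal.span {f}).IsPrime := (Ideal.span_singleton_prime hf.ne_zero).2 hf.prime
  let A := MvPolynomial (Fin 2) L ⧸ Ideal.span {f}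
  let κ := FractionRing A
  let π : MvPolynomial (Fin 2) L →ₐ[L] A := Ideal.Quotient.mkₐ L (Ideal.span {f})
  let ι : A →ₐ[L] κ := IsScalarTower.toAlgHom L A κ
  let ξ : Fin 2 → κ := fun i => ι (π (X i))
  have hξ : ∀ G : MvPolynomial (Fin 2) L, aeval ξ G = ι (π G) := by
    intro G
    have : aeval ξ = ι.comp π := by
      ext i; simp [ξ]
    rw [this]; rfl
  have hι : Function.Injective ι := IsFractionRing.injective A κ
  refine ⟨κ, inferInstance, inferInstance, ξ, ?_, ?_⟩
  · intro G
    rw [hξ, map_eq_zero_iff ι hι, ← Ideal.mem_span_singleton]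
    exact Ideal.Quotient.eq_zero_iff_mem
  · have hmem : ∀ a : A, ι a ∈ Algebra.adjoin L (Set.range ξ) := by
      intro a
      obtain ⟨G, rfl⟩ := Ideal.Quotient.mk_surjective a
      have : ι (π G) ∈ Algebra.adjoin L (Set.range ξ) := by
        rw [← hξ, Algebra.adjoin_range_eq_range_aeval]
        exact ⟨G, rfl⟩
      exact this
    refine ⟨fun y => ?_⟩
    obtain ⟨a, b, hb, rfl⟩ := IsFractionRing.div_surjective (A := A) y
    have hb0 : ι b ≠ 0 := by
      rw [map_ne_zero_iff ι hι]; exact nonZeroDivisors.ne_zero hb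
    refine ⟨Polynomial.C ⟨ι b, hmem b⟩ * Polynomial.X - Polynomial.C ⟨ι a, hmem a⟩, ?_, ?_⟩
    · intro h
      have := congrArg (fun P => P.coeff 1) h
      simp [Polynomial.coeff_C] at this
      exact hb0 (congrArg Subtype.val this)
    · simp only [map_sub, map_mul, Polynomial.aeval_C, Polynomial.aeval_X]
      change ι b * (ι a / ι b) - ι a = 0
      rw [mul_div_cancel₀ _ hb0, sub_self]

lemma aux_dep.{u} {L κ : Type u} [Field L] [Field κ] [Algebra L κ] {f : MvPolynomial (Fin 2) L}
    (hf : f ≠ 0) (ξ : Fin 2 → κ) (hξ : aeval ξ f = 0)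
    [Algebra.IsAlgebraic (Algebra.adjoin L (Set.range ξ)) κ] (η : Fin 2 → κ) :
    ∃ H : MvPolynomial (Fin 2) L, H ≠ 0 ∧ aeval η H = 0 ∧
      ∀ H' : MvPolynomial (Fin 2) L, H' ≠ 0 → aeval η H' = 0 → H.totalDegree ≤ H'.totalDegree := by
  have h1 : ∃ H : MvPolynomial (Fin 2) L, H ≠ 0 ∧ aeval η H = 0 := by
    by_contra! hcon
    have hind : AlgebraicIndependent L η := by
      rw [algebraicIndependent_iff]
      intro p hp
      by_contra h
      exact hcon p h hp
    have hle := hind.lift_cardinalMk_le_trdeg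
    have hb := Algebra.IsAlgebraic.isTranscendenceBasis_of_lift_le_trdeg_of_finite L ξ hle
    exact hf ((algebraicIndependent_iff.1 hb.1) f hξ)
  let S : Set ℕ := {n | ∃ H : MvPolynomial (Fin 2) L, H ≠ 0 ∧ aeval η H = 0 ∧ H.totalDegree = n}
  have hS : S.Nonempty := by
    obtain ⟨H, h, h'⟩ := h1
    exact ⟨_, H, h, h', rfl⟩
  obtain ⟨H, a, b, c⟩ := Nat.sInf_mem hS
  refine ⟨H, a, b, fun H' a' b' => ?_⟩
  rw [c]
  exact Nat.sInf_le ⟨H', a', b', rfl⟩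

lemma aux_pderiv_degree {L : Type*} [Field L] (H : MvPolynomial (Fin 2) L) (i : Fin 2)
    (h : pderiv i H ≠ 0) : (pderiv i H).totalDegree < H.totalDegree := by
  have hne : (pderiv i H).support.Nonempty := by simpa using h
  obtain ⟨m, hm, hmax⟩ := Finset.exists_mem_eq_sup _ hne (fun s : Fin 2 →₀ ℕ => s.sum fun _ e => e)
  have h1 : (pderiv i H).totalDegree = m.sum fun _ e => e := hmax
  rw [h1]
  have h2 : m + Finsupp.single i 1 ∈ H.support := by
    rw [mem_support_iff] at hm ⊢
    rw [coeff_pderiv] at hm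
    exact left_ne_zero_of_mul hm
  have h3 := le_totalDegree h2
  rw [Finsupp.sum_add_index' (by simp) (by simp)] at h3
  simp at h3
  omega

/-- affine version of the flex polynomial -/
noncomputable def flexAff {L : Type*} [CommRing L] (f : MvPolynomial (Fin 2) L) :
    MvPolynomial (Fin 2) L :=
  pderiv 1 f ^ 2 * pderiv 0 (pderiv 0 f) - 2 * pderiv 0 f * pderiv 1 f * pderiv 0 (pderiv 1 f)
    + pderiv 0 f ^ 2 * pderiv 1 (pderiv 1 f)

open TrivSqZeroExt in
lemma aux_bitangent.{u} {L : Type u} [Field L] [IsAlgClosed L] {f : MvPolynomial (Fin 2) L}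
    (hf : Irreducible f) (hT : ¬ f ∣ pderiv 0 f) (hh : ¬ f ∣ flexAff f) :
    ∃ D : MvPolynomial (Fin 2) L, ¬ f ∣ D ∧ ∀ (p q : Fin 2 → L) (s : L),
      eval p f = 0 → eval q f = 0 → eval p (pderiv 0 f) ≠ 0 → eval q (pderiv 0 f) ≠ 0 →
      p 1 ≠ q 1 → eval p (pderiv 1 f) = s * eval p (pderiv 0 f) →
      eval q (pderiv 1 f) = s * eval q (pderiv 0 f) → p 0 + p 1 * s = q 0 + q 1 * s →
      eval p D = 0 := by
  obtain ⟨κ, _, _, ξ, hξ, halg⟩ := aux_generic hf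
  have hfξ : aeval ξ f = 0 := (hξ f).2 dvd_rfl
  set fT := pderiv 0 f with hfT
  set fX := pderiv 1 f with hfX
  have hT0 : aeval ξ fT ≠ 0 := fun h => hT ((hξ _).1 h)
  have hh0 : aeval ξ (flexAff f) ≠ 0 := fun h => hh ((hξ _).1 h)
  let i : κ := (aeval ξ fT)⁻¹
  have hi : aeval ξ fT * i = 1 := mul_inv_cancel₀ hT0
  let η : Fin 2 → κ := ![- (aeval ξ fX * i), ξ 0 + ξ 1 * (aeval ξ fX * i)]
  obtain ⟨H, hH0, hHη, hmin⟩ := aux_dep hf.ne_zero ξ hfξ η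
  have hirr : Irreducible H := irreducible_of_forall_totalDegree_le hmin hH0 hHη
  -- the key relation
  have key0 : ∀ G : MvPolynomial (Fin 2) L, aeval η G = 0 →
      aeval η (pderiv 0 G) = ξ 1 * aeval η (pderiv 1 G) := by
    intro G hG
    obtain ⟨Gh, N, hGh⟩ := aux_hat fT fX G
    have hdvd : f ∣ Gh := by
      rw [← hξ, hGh κ ξ i hi]
      change _ * aeval η G = 0
      rw [hG, mul_zero]
    let w : Fin 2 → κ := ![aeval ξ fX, - aeval ξ fT]
    let V : Fin 2 → DualNumber κ := fun j => inl (ξ j) + inr (w j)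
    have hV0 : aeval V Gh = 0 := by
      obtain ⟨q, rfl⟩ := hdvd
      rw [map_mul, aux_taylor ξ w f, hfξ]
      simp only [w, Matrix.cons_val_zero, Matrix.cons_val_one, ← hfT, ← hfX]
      rw [show aeval ξ fX * aeval ξ fT + -aeval ξ fT * aeval ξ fX = 0 by ring]
      simp
    let r : κ := aeval ξ fX * aeval ξ (pderiv 0 fX) - aeval ξ fT * aeval ξ (pderiv 1 fX)
    let s : κ := aeval ξ fX * aeval ξ (pderiv 0 fT) - aeval ξ fT * aeval ξ (pderiv 1 fT)
    have hVT : aeval V fT = inl (aeval ξ fT) + inr s := by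
      rw [aux_taylor ξ w fT]; simp [w, s]; ring_nf
    have hVX : aeval V fX = inl (aeval ξ fX) + inr r := by
      rw [aux_taylor ξ w fX]; simp [w, r]; ring_nf
    let iV : DualNumber κ := inl i + inr (- s * i ^ 2)
    have hiV : aeval V fT * iV = 1 := by
      rw [hVT]
      ext
      · simp [iV, hi]
      · simp [iV]
        linear_combination (- s * i) * hi
    have h1 := hGh (DualNumber κ) V iV hiV
    rw [hV0] at h1
    have hunit : IsUnit (aeval V fT ^ N) := (IsUnit.of_mul_eq_one _ hiV).pow N
    have h2 := (hunit.mul_right_eq_zero).1 h1.symm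
    let δ : κ := - (r * i - aeval ξ fX * s * i ^ 2)
    have hVη : (![-(aeval V fX * iV), V 0 + V 1 * (aeval V fX * iV)] : Fin 2 → DualNumber κ)
        = fun j => inl (η j) + inr ((![δ, - ξ 1 * δ] : Fin 2 → κ) j) := by
      rw [hVX]
      funext j
      fin_cases j
      · ext <;> simp [iV, η, δ]
        ring
      · ext <;> simp [iV, η, δ, V, w]
        linear_combination (- aeval ξ fX) * hi
    rw [hVη, aux_taylor] at h2
    have h3 := congrArg TrivSqZeroExt.snd h2
    simp at h3
    have hδ : δ ≠ 0 := by
      have : aeval ξ (flexAff f) = δ * aeval ξ fT ^ 2 := by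
        simp only [flexAff, δ, r, s, map_add, map_sub, map_mul, map_pow, ← hfT, ← hfX]
        have hc : pderiv 1 fT = pderiv 0 fX := aux_pderiv_comm _ _ _
        rw [hc]
        simp only [map_ofNat]
        have hi2 : i = (aeval ξ fT)⁻¹ := rfl
        rw [hi2]
        field_simp
        ring
      intro h0
      rw [h0, zero_mul] at this
      exact hh0 this
    have h4 : δ * (aeval η (pderiv 0 G) - ξ 1 * aeval η (pderiv 1 G)) = 0 := by
      linear_combination h3
    exact sub_eq_zero.1 ((mul_eq_zero.1 h4).resolve_left hδ)
  have key : aeval η (pderiv 0 H) = ξ 1 * aeval η (pderiv 1 H) := key0 H hHη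
  have hb : aeval η (pderiv 1 H) ≠ 0 := by
    intro hb
    rw [hb, mul_zero] at key
    obtain ⟨j, hj⟩ := aux_exists_pderiv_ne hirr
    have : aeval η (pderiv j H) = 0 := by
      fin_cases j
      · exact key
      · exact hb
    exact absurd (hmin _ hj this) (not_le.2 (aux_pderiv_degree H j hj))
  obtain ⟨D, N, hD⟩ := aux_hat fT fX (pderiv 1 H)
  obtain ⟨E, N', hE⟩ := aux_hat fT fX (pderiv 0 H - 0)
  refine ⟨D, ?_, ?_⟩
  · rw [← hξ, hD κ ξ i hi]
    exact mul_ne_zero (pow_ne_zero _ hT0) hb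
  · have hdvd : f ∣ fT ^ N * E - fT ^ N' * (X 1 * D) := by
      rw [← hξ]
      simp only [map_sub, map_mul, map_pow, aeval_X, hD κ ξ i hi, hE κ ξ i hi, sub_zero]
      change aeval ξ fT ^ N * (aeval ξ fT ^ N' * aeval η (pderiv 0 H))
        - aeval ξ fT ^ N' * (ξ 1 * (aeval ξ fT ^ N * aeval η (pderiv 1 H))) = 0
      rw [key]; ring
    have hpt : ∀ (p : Fin 2 → L) (s : L), eval p f = 0 → eval p fT ≠ 0 →
        eval p fX = s * eval p fT →
        eval ![-s, p 0 + p 1 * s] (pderiv 0 H) = p 1 * eval ![-s, p 0 + p 1 * s] (pderiv 1 H) ∧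
        eval p D = eval p fT ^ N * eval ![-s, p 0 + p 1 * s] (pderiv 1 H) := by
      intro p s h1 h2 h3
      have hs : eval p fX * (eval p fT)⁻¹ = s := by rw [h3]; field_simp
      have hinv : aeval p fT * (eval p fT)⁻¹ = 1 := by
        rw [aeval_eq_eval]; exact mul_inv_cancel₀ h2
      have hD' := hD L p _ hinv
      have hE' := hE L p _ hinv
      simp only [aeval_eq_eval, sub_zero, hs] at hD' hE'
      have hD'' : eval p D = eval p fT ^ N * eval ![-s, p 0 + p 1 * s] (pderiv 1 H) := hD'
      have hE'' : eval p E = eval p fT ^ N' * eval ![-s, p 0 + p 1 * s] (pderiv 0 H) := hE'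
      refine ⟨?_, hD''⟩
      obtain ⟨q, hq⟩ := hdvd
      have hq' := congrArg (eval p) hq
      simp only [map_sub, map_mul, map_pow, eval_X, h1, zero_mul, hD'', hE''] at hq'
      have h4 : eval p fT ^ N * eval p fT ^ N' ≠ 0 := mul_ne_zero (pow_ne_zero _ h2) (pow_ne_zero _ h2)
      apply mul_left_cancel₀ h4
      linear_combination hq'
    intro p q s hp hq hp1 hq1 hne hp2 hq2 hc
    obtain ⟨e1, e2⟩ := hpt p s hp hp1 hp2
    obtain ⟨e3, -⟩ := hpt q s hq hq1 hq2
    rw [← hc] at e3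
    rw [e2]
    have : (p 1 - q 1) * eval ![-s, p 0 + p 1 * s] (pderiv 1 H) = 0 := by
      linear_combination e3 - e1
    rw [(mul_eq_zero.1 this).resolve_left (sub_ne_zero.2 hne), mul_zero]

/-- restriction of `F` to the line with parameter `u0` -/
noncomputable def lineQ {L : Type*} [Field L] (F : MvPolynomial (Fin 3) L) (α β u0 : L) :
    Polynomial L :=
  aeval ![Polynomial.X, Polynomial.C u0 - Polynomial.C α * Polynomial.X,
    1 + Polynomial.C β * Polynomial.X] F

/-- restriction of `F` to the line at infinity of the pencil -/
noncomputable def lineQinf {L : Type*} [Field L] (F : MvPolynomial (Fin 3) L) (α β : L) :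
    Polynomial L :=
  aeval ![Polynomial.X, 1 - Polynomial.C α * Polynomial.X, Polynomial.C β * Polynomial.X] F

/-- the conditions on `(α, β)` that make the Galois group full -/
structure GoodPair {L : Type*} [Field L] (F : MvPolynomial (Fin 3) L) (α β : L) : Prop where
  center : eval ![1, -α, β] F ≠ 0
  no_triple : ∀ u0 a, ¬ ((Polynomial.X - Polynomial.C a) ^ 3 ∣ lineQ F α β u0)
  no_pair : ∀ u0 a b, a ≠ b → (Polynomial.X - Polynomial.C a) ^ 2 ∣ lineQ F α β u0 →
    (Polynomial.X - Polynomial.C b) ^ 2 ∣ lineQ F α β u0 → False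
  simple_dir : ∀ u0 a, (Polynomial.X - Polynomial.C a) ^ 2 ∣ lineQ F α β u0 →
    eval ![a, u0 - α * a, 1 + β * a] (pderiv 1 F) ≠ 0
  infty : ∀ a, ¬ ((Polynomial.X - Polynomial.C a) ^ 2 ∣ lineQinf F α β)

lemma aux_chain {L : Type*} [Field L] (w : Fin 3 → Polynomial L) (G : MvPolynomial (Fin 3) L) :
    Polynomial.derivative (aeval w G) =
      Polynomial.derivative (w 0) * aeval w (pderiv 0 G) +
      Polynomial.derivative (w 1) * aeval w (pderiv 1 G) +
      Polynomial.derivative (w 2) * aeval w (pderiv 2 G) := by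
  induction G using MvPolynomial.induction_on with
  | C a => simp
  | add p q hp hq => simp only [map_add, hp, hq]; ring
  | mul_X p k hp =>
    simp only [map_mul, aeval_X, Polynomial.derivative_mul, hp, Derivation.leibniz, map_add,
      smul_eq_mul]
    fin_cases k
    · simp [pderiv_X]; ring
    · simp [pderiv_X]; ring
    · simp [pderiv_X]; ring

lemma aux_dvd2 {L : Type*} [Field L] {q : Polynomial L} {a : L}
    (h : (Polynomial.X - Polynomial.C a) ^ 2 ∣ q) :
    q.eval a = 0 ∧ (Polynomial.derivative q).eval a = 0 := by
  obtain ⟨r, rfl⟩ := h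
  simp [Polynomial.derivative_mul, Polynomial.derivative_pow]

lemma aux_dvd3 {L : Type*} [Field L] {q : Polynomial L} {a : L}
    (h : (Polynomial.X - Polynomial.C a) ^ 3 ∣ q) :
    (Polynomial.derivative (Polynomial.derivative q)).eval a = 0 := by
  obtain ⟨r, rfl⟩ := h
  simp [Polynomial.derivative_mul, Polynomial.derivative_pow]

lemma aux_eval_aeval {L : Type*} [Field L] (w : Fin 3 → Polynomial L) (G : MvPolynomial (Fin 3) L)
    (a : L) : (aeval w G).eval a = eval (fun i => (w i).eval a) G := by
  induction G using MvPolynomial.induction_on with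
  | C c => simp
  | add p q hp hq => simp [hp, hq]
  | mul_X p k hp => simp [hp]

lemma aux_rho_pderiv0 {L : Type*} [Field L] (F : MvPolynomial (Fin 3) L) :
    pderiv 0 (aeval ![1, X 0, X 1] F : MvPolynomial (Fin 2) L) =
      aeval ![1, X 0, X 1] (pderiv 1 F) := by
  induction F using MvPolynomial.induction_on with
  | C a => simp
  | add p q hp hq => simp only [map_add, hp, hq]
  | mul_X p k hp =>
    simp only [map_mul, aeval_X, hp, Derivation.leibniz, map_add, smul_eq_mul]
    fin_cases k
    · simp [pderiv_X]
    · simp [pderiv_X]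
    · simp [pderiv_X]

lemma aux_rho_pderiv1 {L : Type*} [Field L] (F : MvPolynomial (Fin 3) L) :
    pderiv 1 (aeval ![1, X 0, X 1] F : MvPolynomial (Fin 2) L) =
      aeval ![1, X 0, X 1] (pderiv 2 F) := by
  induction F using MvPolynomial.induction_on with
  | C a => simp
  | add p q hp hq => simp only [map_add, hp, hq]
  | mul_X p k hp =>
    simp only [map_mul, aeval_X, hp, Derivation.leibniz, map_add, smul_eq_mul]
    fin_cases k
    · simp [pderiv_X]
    · simp [pderiv_X]
    · simp [pderiv_X]

lemma aux_rho_aeval {L R : Type*} [Field L] [CommRing R] [Algebra L R] (F : MvPolynomial (Fin 3) L)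
    (p : Fin 2 → R) :
    aeval p (aeval ![1, X 0, X 1] F : MvPolynomial (Fin 2) L) = aeval ![1, p 0, p 1] F := by
  have : (aeval p).comp (aeval ![1, X 0, X 1] : MvPolynomial (Fin 3) L →ₐ[L] MvPolynomial (Fin 2) L)
      = aeval ![1, p 0, p 1] := by
    ext i
    fin_cases i <;> simp
  rw [← this]; rfl

lemma aux_rho_eval {L : Type*} [Field L] (F : MvPolynomial (Fin 3) L)
    (p : Fin 2 → L) :
    eval p (aeval ![1, X 0, X 1] F : MvPolynomial (Fin 2) L) = eval ![1, p 0, p 1] F := by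
  have := aux_rho_aeval F p
  simpa [aeval_eq_eval] using this

lemma aux_rho_flex {L : Type*} [Field L] (F : MvPolynomial (Fin 3) L) :
    flexAff (aeval ![1, X 0, X 1] F : MvPolynomial (Fin 2) L) =
      aeval ![1, X 0, X 1] (flexPoly F) := by
  simp only [flexAff, flexPoly, aux_rho_pderiv0, aux_rho_pderiv1, map_add, map_sub, map_mul,
    map_pow, map_ofNat]

lemma aux_top {L : Type*} [Field L] {F : MvPolynomial (Fin 3) L} {d : ℕ} (hd : 1 ≤ d)
    (hF : F.IsHomogeneous d)
    (hdeg : (aeval ![1, X 0, X 1] F : MvPolynomial (Fin 2) L).totalDegree = d) :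
    (aeval ![0, Polynomial.X, 1] F : Polynomial L) ≠ 0 := by
  intro h0
  have hsum : ∀ m ∈ F.support, m 0 + m 1 + m 2 = d := by
    intro m hm
    have := hF (mem_support_iff.1 hm)
    rw [Finsupp.weight_apply, Finsupp.sum_fintype _ _ (by simp)] at this
    simpa [Fin.sum_univ_three] using this
  have hpos : ∀ m ∈ F.support, m 0 ≠ 0 := by
    intro m hm hm0
    have h1 := congrArg (fun P => P.coeff (m 1)) h0
    simp only [Polynomial.coeff_zero] at h1
    rw [aeval_def, eval₂_eq', Polynomial.finsetSum_coeff] at h1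
    rw [Finset.sum_eq_single m] at h1
    · simp [Fin.prod_univ_three, hm0] at h1
      exact (mem_support_iff.1 hm) h1
    · intro m' hm' hne
      simp only [Fin.prod_univ_three]
      by_cases h : m' 0 = 0
      · have hne1 : m' 1 ≠ m 1 := by
          intro h1
          apply hne
          have := hsum m hm
          have := hsum m' hm'
          ext i
          fin_cases i <;> simp <;> omega
        simp [h, Polynomial.coeff_X_pow, Ne.symm hne1]
      · simp [h]
    · intro h; exact absurd hm h
  have hle : (aeval ![1, X 0, X 1] F : MvPolynomial (Fin 2) L).totalDegree ≤ d - 1 := by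
    rw [aeval_def, eval₂_eq']
    refine totalDegree_finsetSum_le fun m hm => ?_
    have h1 := hsum m hm
    have h2 := hpos m hm
    simp only [Fin.prod_univ_three]
    simp only [Matrix.cons_val_zero, one_pow, one_mul, Matrix.cons_val_one, Matrix.cons_val]
    refine (totalDegree_mul _ _).trans ?_
    rw [algebraMap_eq, totalDegree_C, zero_add]
    refine (totalDegree_mul _ _).trans ?_
    have := totalDegree_X_pow (R := L) (0 : Fin 2) (m 1)
    have := totalDegree_X_pow (R := L) (1 : Fin 2) (m 2)
    omega
  omega

lemma aux_not_dvd_flex {L : Type*} [Field L] [IsAlgClosed L]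
    {F : MvPolynomial (Fin 3) L} {d : ℕ} (hd : 2 ≤ d)
    (h2 : (2 : L) ≠ 0) (hd1 : ((d - 1 : ℕ) : L) ≠ 0)
    (hF : F.IsHomogeneous d)
    (hsm : ∀ x : Fin 3 → L, x ≠ 0 → eval x F = 0 → ∃ j, eval x (pderiv j F) ≠ 0)
    (hdeg : (aeval ![1, X 0, X 1] F : MvPolynomial (Fin 2) L).totalDegree = d)
    (hirr : Irreducible (aeval ![1, X 0, X 1] F : MvPolynomial (Fin 2) L)) :
    ¬ (aeval ![1, X 0, X 1] F : MvPolynomial (Fin 2) L) ∣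
      flexAff (aeval ![1, X 0, X 1] F : MvPolynomial (Fin 2) L) := by
  obtain ⟨κ, _, _, ξ, hξ, -⟩ := aux_generic hirr
  rw [← hξ, aux_rho_flex, aux_rho_aeval]
  refine aux_flex hd h2 hd1 hF hsm _ rfl ?_ 1 ?_
  · rw [← aux_rho_aeval, hξ]
  · rintro ⟨a, ha⟩
    have : aeval ξ (X 0 - C a : MvPolynomial (Fin 2) L) = 0 := by
      simp [ha]
    rw [hξ] at this
    have hne : (X 0 - C a : MvPolynomial (Fin 2) L) ≠ 0 := by
      intro h
      have h5 := congrArg (eval ![a + 1, 0]) h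
      simp at h5
    have h3 := totalDegree_le_of_dvd_of_isDomain this hne
    have h4 : (X 0 - C a : MvPolynomial (Fin 2) L).totalDegree ≤ 1 :=
      (totalDegree_sub_C_le _ _).trans (by simp)
    omega

lemma aux_not_dvd_T {L : Type*} [Field L] {f : MvPolynomial (Fin 2) L}
    (h : ¬ f ∣ flexAff f) : ¬ f ∣ pderiv 0 f := by
  intro h1
  apply h
  have h0 : pderiv 0 f = 0 := by
    by_contra hne
    have h3 := totalDegree_le_of_dvd_of_isDomain h1 hne
    have h4 := aux_pderiv_degree f 0 hne
    omega
  have : flexAff f = 0 := by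
    rw [flexAff, aux_pderiv_comm 0 1, h0]; simp
  rw [this]; exact dvd_zero _

lemma aux_scale_eval {L σ : Type*} [Field L] {F : MvPolynomial σ L} {d : ℕ}
    (hF : F.IsHomogeneous d) (c : L) (v : σ → L) :
    eval (fun i => c * v i) F = c ^ d * eval v F := by
  have := aux_scale hF c v
  simpa [aeval_eq_eval] using this

lemma aux_euler_eval {L : Type*} [Field L]
    {F : MvPolynomial (Fin 3) L} {d : ℕ}
    (hF : F.IsHomogeneous d) (v : Fin 3 → L) :
    v 0 * eval v (pderiv 0 F) + v 1 * eval v (pderiv 1 F) + v 2 * eval v (pderiv 2 F)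
      = (d : L) * eval v F := by
  have := aux_euler hF v
  simpa [aeval_eq_eval] using this

lemma aux_lineQ_eval {L : Type*} [Field L] (F : MvPolynomial (Fin 3) L) (α β u0 a : L) :
    (lineQ F α β u0).eval a = eval ![a, u0 - α * a, 1 + β * a] F := by
  rw [lineQ, aux_eval_aeval]
  congr 1
  apply congrArg
  funext i; fin_cases i <;> simp

lemma aux_lineQ_deriv {L : Type*} [Field L] (F : MvPolynomial (Fin 3) L) (α β u0 : L) :
    Polynomial.derivative (lineQ F α β u0) = lineQ (pderiv 0 F) α β u0
      - Polynomial.C α * lineQ (pderiv 1 F) α β u0 + Polynomial.C β * lineQ (pderiv 2 F) α β u0 := by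
  rw [lineQ, aux_chain]
  simp [lineQ]
  ring

lemma aux_lineQinf_eval {L : Type*} [Field L] (F : MvPolynomial (Fin 3) L) (α β a : L) :
    (lineQinf F α β).eval a = eval ![a, 1 - α * a, β * a] F := by
  rw [lineQinf, aux_eval_aeval]
  congr 1
  apply congrArg
  funext i; fin_cases i <;> simp

lemma aux_lineQinf_deriv {L : Type*} [Field L] (F : MvPolynomial (Fin 3) L) (α β : L) :
    Polynomial.derivative (lineQinf F α β) = lineQinf (pderiv 0 F) α β
      - Polynomial.C α * lineQinf (pderiv 1 F) α β + Polynomial.C β * lineQinf (pderiv 2 F) α β := by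
  rw [lineQinf, aux_chain]
  simp [lineQinf]
  ring

lemma aux_good_of {L : Type*} [Field L]
    {F : MvPolynomial (Fin 3) L} {d : ℕ} 
    (hF : F.IsHomogeneous d)
    (hsm : ∀ x : Fin 3 → L, x ≠ 0 → eval x F = 0 → ∃ j, eval x (pderiv j F) ≠ 0)
    {f : MvPolynomial (Fin 2) L} (hf : f = aeval ![1, X 0, X 1] F) (D : MvPolynomial (Fin 2) L)
    (hD : ∀ (p q : Fin 2 → L) (s : L),
      eval p f = 0 → eval q f = 0 → eval p (pderiv 0 f) ≠ 0 → eval q (pderiv 0 f) ≠ 0 →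
      p 1 ≠ q 1 → eval p (pderiv 1 f) = s * eval p (pderiv 0 f) →
      eval q (pderiv 1 f) = s * eval q (pderiv 0 f) → p 0 + p 1 * s = q 0 + q 1 * s →
      eval p D = 0)
    (α β : L) (hc : eval ![1, -α, β] F ≠ 0)
    (hB1 : ∀ p : Fin 2 → L, eval p f = 0 → eval p (flexAff f * D * pderiv 0 f) = 0 →
      eval ![1, p 0, p 1] (pderiv 0 F) - α * eval ![1, p 0, p 1] (pderiv 1 F)
        + β * eval ![1, p 0, p 1] (pderiv 2 F) ≠ 0)
    (hB2 : ∀ u : L, eval ![0, u, 1] F = 0 → 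
      eval ![0, u, 1] (pderiv 0 F) - α * eval ![0, u, 1] (pderiv 1 F)
        + β * eval ![0, u, 1] (pderiv 2 F) ≠ 0)
    (hB3 : eval ![0, 1, 0] F = 0 → 
      eval ![0, 1, 0] (pderiv 0 F) - α * eval ![0, 1, 0] (pderiv 1 F)
        + β * eval ![0, 1, 0] (pderiv 2 F) ≠ 0) :
    GoodPair F α β := by
  have hf0 : pderiv 0 f = aeval ![1, X 0, X 1] (pderiv 1 F) := by rw [hf, aux_rho_pderiv0]
  have hf1 : pderiv 1 f = aeval ![1, X 0, X 1] (pderiv 2 F) := by rw [hf, aux_rho_pderiv1]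
  have hfl : flexAff f = aeval ![1, X 0, X 1] (flexPoly F) := by rw [hf, aux_rho_flex]
  -- consequences of a double root
  have hdbl : ∀ u0 a, (Polynomial.X - Polynomial.C a) ^ 2 ∣ lineQ F α β u0 →
      let P : Fin 3 → L := ![a, u0 - α * a, 1 + β * a]
      eval P F = 0 ∧ (eval P (pderiv 0 F) - α * eval P (pderiv 1 F) + β * eval P (pderiv 2 F) = 0)
      ∧ eval P (pderiv 2 F) = - u0 * eval P (pderiv 1 F) ∧ eval P (pderiv 1 F) ≠ 0 ∧ a ≠ 0 := by
    intro u0 a h P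
    obtain ⟨h1, h2⟩ := aux_dvd2 h
    rw [aux_lineQ_eval] at h1
    rw [aux_lineQ_deriv] at h2
    simp only [Polynomial.eval_add, Polynomial.eval_sub, Polynomial.eval_mul, Polynomial.eval_C,
      aux_lineQ_eval] at h2
    have hE := aux_euler_eval hF P
    change eval P F = 0 at h1
    change eval P (pderiv 0 F) - α * eval P (pderiv 1 F) + β * eval P (pderiv 2 F) = 0 at h2
    rw [h1, mul_zero] at hE
    simp only [P, Matrix.cons_val_zero, Matrix.cons_val_one, Matrix.cons_val] at hE
    change a * eval P (pderiv 0 F) + (u0 - α * a) * eval P (pderiv 1 F)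
      + (1 + β * a) * eval P (pderiv 2 F) = 0 at hE
    have h3 : eval P (pderiv 2 F) = - u0 * eval P (pderiv 1 F) := by
      linear_combination hE - a * h2
    refine ⟨h1, h2, h3, ?_, ?_⟩
    · intro h4
      rw [h4, mul_zero] at h3
      rw [h4, h3] at h2
      have h5 : eval P (pderiv 0 F) = 0 := by linear_combination h2
      have hP : P ≠ 0 := by
        intro h0
        have e0 : a = 0 := congrFun h0 0
        have e2 : 1 + β * a = 0 := congrFun h0 2
        rw [e0] at e2; simp at e2
      obtain ⟨j, hj⟩ := hsm P hP h1
      apply hj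
      fin_cases j
      · exact h5
      · exact h4
      · exact h3
    · intro h0
      have hPe : P = ![0, u0, 1] := by
        funext i; fin_cases i <;> simp [P, h0]
      rw [hPe] at h1 h2
      exact hB2 u0 h1 h2
  -- the affine point
  have hscale : ∀ u0 a, a ≠ 0 → ∀ (G : MvPolynomial (Fin 3) L) (n : ℕ), G.IsHomogeneous n →
      eval ![a, u0 - α * a, 1 + β * a] G = a ^ n * eval ![1, -α + u0 * a⁻¹, β + a⁻¹] G := by
    intro u0 a ha G n hG
    rw [← aux_scale_eval hG]
    congr 1
    apply congrArg
    funext i; fin_cases i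
    · simp
    · simp; field_simp; ring
    · simp; field_simp; ring
  have haff : ∀ u0 a, (Polynomial.X - Polynomial.C a) ^ 2 ∣ lineQ F α β u0 →
      let p : Fin 2 → L := ![-α + u0 * a⁻¹, β + a⁻¹]
      a ≠ 0 ∧ eval p f = 0 ∧ eval p (pderiv 1 f) = - u0 * eval p (pderiv 0 f) ∧
      eval p (flexAff f) ≠ 0 ∧ eval p D ≠ 0 ∧ eval p (pderiv 0 f) ≠ 0 ∧
      (eval ![1, -α + u0 * a⁻¹, β + a⁻¹] (pderiv 0 F)
        - α * eval ![1, -α + u0 * a⁻¹, β + a⁻¹] (pderiv 1 F)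
        + β * eval ![1, -α + u0 * a⁻¹, β + a⁻¹] (pderiv 2 F) = 0) := by
    intro u0 a h p
    obtain ⟨h1, h2, h3, h4, ha⟩ := hdbl u0 a h
    have hP := hscale u0 a ha
    rw [hP _ _ hF] at h1
    rw [hP _ _ hF.pderiv, hP _ _ hF.pderiv, hP _ _ hF.pderiv] at h2
    rw [hP _ _ hF.pderiv, hP _ _ hF.pderiv] at h3
    have h1' := (mul_eq_zero.1 h1).resolve_left (pow_ne_zero _ ha)
    have ha1 : a ^ (d - 1) ≠ 0 := pow_ne_zero _ ha
    have h2' : eval ![1, -α + u0 * a⁻¹, β + a⁻¹] (pderiv 0 F)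
        - α * eval ![1, -α + u0 * a⁻¹, β + a⁻¹] (pderiv 1 F)
        + β * eval ![1, -α + u0 * a⁻¹, β + a⁻¹] (pderiv 2 F) = 0 := by
      apply mul_left_cancel₀ ha1; linear_combination h2
    have h3' : eval ![1, -α + u0 * a⁻¹, β + a⁻¹] (pderiv 2 F)
        = - u0 * eval ![1, -α + u0 * a⁻¹, β + a⁻¹] (pderiv 1 F) := by
      apply mul_left_cancel₀ ha1; linear_combination h3
    have hpf : eval p f = 0 := by
      rw [hf, aux_rho_eval]; exact h1'
    have hne : eval p (flexAff f * D * pderiv 0 f) ≠ 0 := by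
      intro h0
      exact hB1 p hpf h0 h2'
    rw [map_mul, map_mul] at hne
    refine ⟨ha, hpf, ?_, left_ne_zero_of_mul (left_ne_zero_of_mul hne),
      right_ne_zero_of_mul (left_ne_zero_of_mul hne), right_ne_zero_of_mul hne, h2'⟩
    rw [hf0, hf1, aux_rho_eval, aux_rho_eval]
    exact h3'
  refine ⟨hc, ?_, ?_, ?_, ?_⟩
  · intro u0 a h
    have hsq : (Polynomial.X - Polynomial.C a) ^ 2 ∣ lineQ F α β u0 :=
      (pow_dvd_pow _ (by norm_num)).trans h
    obtain ⟨ha, h1, h2, h3, -, -, hdot⟩ := haff u0 a hsq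
    apply h3
    have h5 := aux_dvd3 h
    rw [aux_lineQ_deriv] at h5
    simp only [Polynomial.derivative_add, Polynomial.derivative_sub, Polynomial.derivative_C_mul,
      aux_lineQ_deriv, Polynomial.eval_add, Polynomial.eval_sub, Polynomial.eval_mul,
      Polynomial.eval_C, aux_lineQ_eval, hscale u0 a ha _ _ hF.pderiv.pderiv] at h5
    have ha2 : a ^ (d - 1 - 1) ≠ 0 := pow_ne_zero _ ha
    rw [hf0, hf1, aux_rho_eval, aux_rho_eval] at h2
    rw [hfl, aux_rho_eval]
    simp only [Matrix.cons_val_zero, Matrix.cons_val_one] at h2 ⊢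
    set P : Fin 3 → L := ![1, -α + u0 * a⁻¹, β + a⁻¹] with hPdef
    have E0 := aux_euler_eval (hF.pderiv (i := 0)) P
    have E1 := aux_euler_eval (hF.pderiv (i := 1)) P
    have E2 := aux_euler_eval (hF.pderiv (i := 2)) P
    have P0 : P 0 = 1 := rfl
    have P1 : P 1 = -α + u0 * a⁻¹ := rfl
    have P2 : P 2 = β + a⁻¹ := rfl
    rw [P0, P1, P2] at E0 E1 E2
    rw [aux_pderiv_comm 1 0, aux_pderiv_comm 2 0] at h5 E0
    rw [aux_pderiv_comm 2 1] at h5 E1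
    have h6 : eval P (pderiv 0 (pderiv 0 F)) - 2 * α * eval P (pderiv 0 (pderiv 1 F))
        + 2 * β * eval P (pderiv 0 (pderiv 2 F)) + α ^ 2 * eval P (pderiv 1 (pderiv 1 F))
        - 2 * α * β * eval P (pderiv 1 (pderiv 2 F)) + β ^ 2 * eval P (pderiv 2 (pderiv 2 F)) = 0 := by
      apply mul_left_cancel₀ ha2; linear_combination h5
    have h7 : u0 ^ 2 * eval P (pderiv 1 (pderiv 1 F)) + 2 * u0 * eval P (pderiv 1 (pderiv 2 F))
        + eval P (pderiv 2 (pderiv 2 F)) = 0 := by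
      -- e = (P - O) * a
      have hai : a * a⁻¹ = 1 := mul_inv_cancel₀ ha
      have hai2 : a⁻¹ ^ 2 ≠ 0 := pow_ne_zero _ (inv_ne_zero ha)
      apply mul_left_cancel₀ hai2
      have hE : P 0 * eval P (pderiv 0 F) + P 1 * eval P (pderiv 1 F) + P 2 * eval P (pderiv 2 F)
        = 0 := by
        rw [aux_euler_eval hF P]
        rw [hf, aux_rho_eval] at h1
        have : eval P F = 0 := h1
        rw [this, mul_zero]
      rw [P0, P1, P2] at hE
      linear_combination E0 * 1 + E1 * (-α + u0 * a⁻¹) + E2 * (β + a⁻¹)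
        - 2 * (E0 - α * E1 + β * E2) + h6 + ((d - 1 : ℕ) : L) * hE - 2 * ((d - 1 : ℕ) : L) * hdot
    simp only [flexPoly, map_add, map_sub, map_mul, map_pow, map_ofNat]
    rw [h2]
    linear_combination (eval P (pderiv 1 F)) ^ 2 * h7
  · intro u0 a b hab h1 h2
    obtain ⟨ha, a1, a2, -, a3, a4, -⟩ := haff u0 a h1
    obtain ⟨hb, b1, b2, -, -, b4, -⟩ := haff u0 b h2
    apply a3
    refine hD _ _ (-u0) a1 b1 a4 b4 ?_ a2 b2 ?_
    · simpa using hab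
    · simp; ring
  · intro u0 a h
    exact (hdbl u0 a h).2.2.2.1
  · intro a h
    obtain ⟨h1, h2⟩ := aux_dvd2 h
    rw [aux_lineQinf_eval] at h1
    rw [aux_lineQinf_deriv] at h2
    simp only [Polynomial.eval_add, Polynomial.eval_sub, Polynomial.eval_mul, Polynomial.eval_C,
      aux_lineQinf_eval] at h2
    by_cases ha : a = 0
    · subst ha
      simp only [mul_zero, sub_zero] at h1 h2
      exact hB3 h1 h2
    set P : Fin 3 → L := ![a, 1 - α * a, β * a] with hP
    have hE := aux_euler_eval hF P
    rw [h1, mul_zero] at hE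
    have P0 : P 0 = a := rfl
    have P1 : P 1 = 1 - α * a := rfl
    have P2 : P 2 = β * a := rfl
    rw [P0, P1, P2] at hE
    have h3 : eval P (pderiv 1 F) = 0 := by linear_combination hE - a * h2
    have hs : ∀ (G : MvPolynomial (Fin 3) L) (n : ℕ), G.IsHomogeneous n →
        eval P G = a ^ n * eval ![1, -α + a⁻¹, β] G := by
      intro G n hG
      rw [← aux_scale_eval hG]
      congr 1
      apply congrArg
      funext i; fin_cases i
      · simp [hP]
      · simp [hP]; field_simp; ring
      · simp [hP]; field_simp
    have ha1 : a ^ (d - 1) ≠ 0 := pow_ne_zero _ ha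
    rw [hs _ _ hF] at h1
    rw [hs _ _ hF.pderiv] at h3
    rw [hs _ _ hF.pderiv, hs _ _ hF.pderiv, hs _ _ hF.pderiv] at h2
    have h1' := (mul_eq_zero.1 h1).resolve_left (pow_ne_zero _ ha)
    have h3' := (mul_eq_zero.1 h3).resolve_left (pow_ne_zero _ ha)
    refine hB1 ![-α + a⁻¹, β] ?_ ?_ ?_
    · rw [hf, aux_rho_eval]; exact h1'
    · rw [map_mul, hf0, aux_rho_eval]
      simp only [Matrix.cons_val_zero, Matrix.cons_val_one]
      rw [h3', mul_zero]
    · simp only [Matrix.cons_val_zero, Matrix.cons_val_one]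
      apply mul_left_cancel₀ ha1; linear_combination h2

lemma aux_linform_ne {L : Type*} [Field L] (v : Fin 3 → L) (hv : ∃ j, v j ≠ 0) :
    (C (v 0) - X 0 * C (v 1) + X 1 * C (v 2) : MvPolynomial (Fin 2) L) ≠ 0 := by
  intro h
  have e : ∀ a b : L, v 0 - a * v 1 + b * v 2 = 0 := by
    intro a b
    have := congrArg (eval ![a, b]) h
    simpa using this
  have h0 := e 0 0
  have h1 := e 1 0
  have h2 := e 0 1
  simp only [zero_mul, one_mul, sub_zero, add_zero] at h0 h1 h2
  rw [h0] at h1 h2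
  obtain ⟨j, hj⟩ := hv
  fin_cases j
  · exact hj h0
  · apply hj; simpa using h1
  · apply hj; simpa using h2

lemma aux_ev2 {L : Type*} [Field L] (w : Fin 3 → MvPolynomial (Fin 2) L)
    (F : MvPolynomial (Fin 3) L) (p : Fin 2 → L) :
    eval p (aeval w F) = eval (fun i => eval p (w i)) F := by
  induction F using MvPolynomial.induction_on with
  | C a => simp
  | add p q hp hq => simp only [map_add, hp, hq]
  | mul_X q k hp => simp only [map_mul, aeval_X, hp, eval_X]

lemma aux_exists_B {L : Type*} [Field L] [IsAlgClosed L]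
    {F : MvPolynomial (Fin 3) L} {d : ℕ} (hd : 2 ≤ d)
    (h2 : (2 : L) ≠ 0) (hd1 : ((d - 1 : ℕ) : L) ≠ 0)
    (hF : F.IsHomogeneous d)
    (hsm : ∀ x : Fin 3 → L, x ≠ 0 → eval x F = 0 → ∃ j, eval x (pderiv j F) ≠ 0)
    (hdeg : (aeval ![1, X 0, X 1] F : MvPolynomial (Fin 2) L).totalDegree = d)
    (hirr : Irreducible (aeval ![1, X 0, X 1] F : MvPolynomial (Fin 2) L)) :
    ∃ B : MvPolynomial (Fin 2) L, B ≠ 0 ∧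
      ∀ α β, eval ![α, β] B ≠ 0 → GoodPair F α β := by
  classical
  have hflex := aux_not_dvd_flex hd h2 hd1 hF hsm hdeg hirr
  have hT := aux_not_dvd_T hflex
  have htop := aux_top (by omega) hF hdeg
  obtain ⟨D, hD, hD2⟩ := aux_bitangent hirr hT hflex
  obtain ⟨f, hf⟩ : ∃ f, f = (aeval ![1, X 0, X 1] F : MvPolynomial (Fin 2) L) := ⟨_, rfl⟩
  rw [← hf] at hirr hflex hT hdeg hD hD2
  have hfev : ∀ p : Fin 2 → L, eval p f = eval ![1, p 0, p 1] F := by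
    intro p
    rw [hf, aux_ev2]
    congr 2
    funext i
    fin_cases i <;> simp
  have hprime : Prime f := hirr.prime
  have hprod : ¬ f ∣ flexAff f * D * pderiv 0 f := by
    intro h
    rcases hprime.dvd_or_dvd h with h | h
    · rcases hprime.dvd_or_dvd h with h | h
      · exact hflex h
      · exact hD h
    · exact hT h
  have hfin1 := aux_finite_zeros f _ hirr hprod
  have hev2 : ∀ u : L, (aeval ![0, Polynomial.X, 1] F : Polynomial L).eval u
      = eval ![0, u, 1] F := by
    intro u
    rw [aux_eval_aeval]
    congr 2
    funext i
    fin_cases i <;> simp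
  have hfin2 : {u : L | eval ![0, u, 1] F = 0}.Finite := by
    refine (Polynomial.finite_setOfPred_isRoot htop).subset ?_
    intro u hu
    simpa [Polynomial.IsRoot, hev2] using hu
  let Bad : Set (Fin 3 → L) :=
    (Set.image (fun p : Fin 2 → L => ![1, p 0, p 1]) {p | eval p f = 0 ∧
      eval p (flexAff f * D * pderiv 0 f) = 0}) ∪
    (Set.image (fun u : L => ![0, u, 1]) {u : L | eval ![0, u, 1] F = 0}) ∪
    {v | v = ![0, 1, 0] ∧ eval v F = 0}
  have hBfin : Bad.Finite := by
    refine ((hfin1.image _).union (hfin2.image _)).union ?_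
    exact (Set.finite_singleton (![0, 1, 0] : Fin 3 → L)).subset (fun v hv => hv.1)
  have hBad : ∀ v ∈ Bad, v ≠ 0 ∧ eval v F = 0 := by
    rintro v ((⟨p, hp, rfl⟩ | ⟨u, hu, rfl⟩) | ⟨rfl, hv⟩)
    · refine ⟨fun h => ?_, ?_⟩
      · have := congrFun h 0
        simp at this
      · have := hp.1
        rwa [hfev] at this
    · refine ⟨fun h => ?_, hu⟩
      have := congrFun h 2
      simp at this
    · refine ⟨fun h => ?_, hv⟩
      have := congrFun h 1
      simp at this
  let lin : (Fin 3 → L) → MvPolynomial (Fin 2) L := fun v =>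
    C (eval v (pderiv 0 F)) - X 0 * C (eval v (pderiv 1 F)) + X 1 * C (eval v (pderiv 2 F))
  let A : MvPolynomial (Fin 2) L := aeval ![1, - X 0, X 1] F
  have hAev : ∀ α β, eval ![α, β] A = eval ![1, -α, β] F := by
    intro α β
    show eval ![α, β] (aeval ![1, - X 0, X 1] F) = _
    rw [aux_ev2]
    congr 2
    funext i
    fin_cases i <;> simp
  have hA : A ≠ 0 := by
    intro h0
    apply hirr.ne_zero
    apply MvPolynomial.funext
    intro p
    rw [hfev, map_zero]
    have := hAev (- p 0) (p 1)
    rw [h0, map_zero, neg_neg] at this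
    exact this.symm
  refine ⟨A * ∏ v ∈ hBfin.toFinset, lin v, ?_, ?_⟩
  · refine mul_ne_zero hA (Finset.prod_ne_zero_iff.mpr ?_)
    intro v hv
    rw [Set.Finite.mem_toFinset] at hv
    obtain ⟨h0, h1⟩ := hBad v hv
    exact aux_linform_ne (fun j => eval v (pderiv j F)) (hsm v h0 h1)
  · intro α β hαβ
    rw [map_mul, map_prod] at hαβ
    have hc := left_ne_zero_of_mul hαβ
    have hl : ∀ v ∈ Bad, eval v (pderiv 0 F) - α * eval v (pderiv 1 F)
        + β * eval v (pderiv 2 F) ≠ 0 := by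
      intro v hv
      have := Finset.prod_ne_zero_iff.mp (right_ne_zero_of_mul hαβ) v
        (by rw [Set.Finite.mem_toFinset]; exact hv)
      simpa [lin] using this
    rw [hAev] at hc
    refine aux_good_of hF hsm hf D hD2 α β hc ?_ ?_ ?_
    · intro p h1 h2
      exact hl _ (Or.inl (Or.inl ⟨p, ⟨h1, h2⟩, rfl⟩))
    · intro u hu
      exact hl _ (Or.inl (Or.inr ⟨u, hu, rfl⟩))
    · intro h
      exact hl _ (Or.inr ⟨rfl, h⟩)

/-- An elementary form of: trivial inertia forces the uniformizer downstairs to have valuation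
one upstairs. -/
lemma aux_unram {B L G : Type*} [CommRing B] [IsDomain B] [Field L] [Group G] [Fintype G]
    [MulSemiringAction G B] (ψ : B →+* L) (ι : L →+* B) (hι : ∀ a, ψ (ι a) = a)
    (π : B) (hπ0 : π ≠ 0) (hπψ : ψ π = 0)
    (hπ : ∀ y : B, (∀ σ : G, σ • y = y) → ψ y = 0 → π ∣ y)
    (hG : ∀ σ : G, σ ≠ 1 → ∃ b : B, ψ (σ • b) ≠ ψ b)
    (hιfix : ∀ (σ : G) a, σ • ι a = ι a)
    (x y w k : B) (hx : ψ x = 0) (hy : ψ y = 0) (hk : ψ k ≠ 0) (h : π * k = x * y * w) :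
    False := by
  classical
  have h1 : ∀ σ : G, σ ≠ 1 → ∃ b : B, ψ b = 1 ∧ ψ (σ • b) = 0 := by
    intro σ hσ
    obtain ⟨b, hb⟩ := hG σ hσ
    refine ⟨(b - ι (ψ (σ • b))) * ι ((ψ b - ψ (σ • b))⁻¹), ?_, ?_⟩
    · rw [map_mul, map_sub, hι, hι, mul_inv_cancel₀ (sub_ne_zero.mpr (Ne.symm hb))]
    · rw [smul_mul', smul_sub, hιfix, hιfix, map_mul, map_sub, hι, sub_self, zero_mul]
  choose! c hc1 hc2 using h1
  let e : B := ∏ σ ∈ Finset.univ.erase (1 : G), c σ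
  have he1 : ψ e = 1 := by
    rw [map_prod]
    exact Finset.prod_eq_one fun σ hσ => hc1 σ (Finset.ne_of_mem_erase hσ)
  have he2 : ∀ σ : G, σ ≠ 1 → ψ (σ • e) = 0 := by
    intro σ hσ
    rw [Finset.smul_prod', map_prod]
    exact Finset.prod_eq_zero (Finset.mem_erase.mpr ⟨hσ, Finset.mem_univ _⟩) (hc2 σ hσ)
  let M : Matrix G G B := Matrix.of fun τ σ => (σ * τ⁻¹) • e
  have hM : M.det ≠ 0 ∧ ψ M.det = 1 := by
    have : ψ M.det = 1 := by
      rw [RingHom.map_det]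
      have : ψ.mapMatrix M = 1 := by
        ext τ σ
        simp only [RingHom.mapMatrix_apply, Matrix.map_apply, Matrix.one_apply, M, Matrix.of_apply]
        split_ifs with hh
        · subst hh; simp [he1]
        · exact he2 _ (fun h => hh (by rw [mul_inv_eq_one] at h; exact h.symm))
      rw [this, Matrix.det_one]
    refine ⟨fun h0 => ?_, this⟩
    rw [h0, map_zero] at this
    exact zero_ne_one this
  have key : ∀ y : B, (∀ σ : G, ψ (σ • y) = 0) → π ∣ M.det * y := by
    intro y hy
    let v : G → B := fun σ => σ • y
    have hr : ∀ τ, π ∣ (M.mulVec v) τ := by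
      intro τ
      apply hπ
      · intro ρ
        simp only [Matrix.mulVec, dotProduct, M, v, Matrix.of_apply]
        rw [Finset.smul_sum]
        simp only [smul_mul', smul_smul, ← mul_assoc]
        exact Fintype.sum_equiv (Equiv.mulLeft ρ) _ _ (fun σ => rfl)
      · simp only [Matrix.mulVec, dotProduct, M, v, Matrix.of_apply]
        rw [map_sum]
        refine Finset.sum_eq_zero fun σ _ => ?_
        rw [map_mul, hy, mul_zero]
    have h2 : M.adjugate.mulVec (M.mulVec v) = M.det • v := by
      rw [Matrix.mulVec_mulVec, Matrix.adjugate_mul, Matrix.smul_mulVec, Matrix.one_mulVec]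
    have h3 := congrFun h2 1
    simp only [Pi.smul_apply, smul_eq_mul, v, one_smul] at h3
    rw [← h3]
    exact Finset.dvd_sum fun τ _ => Dvd.dvd.mul_left (hr τ) _
  have key2 : ∀ y : B, ψ y = 0 → π ∣ M.det * (e * y) := by
    intro y hy
    apply key
    intro σ
    rw [smul_mul', map_mul]
    by_cases hσ : σ = 1
    · subst hσ; simp [hy]
    · rw [he2 σ hσ, zero_mul]
  obtain ⟨x', hx'⟩ := key2 x hx
  obtain ⟨y', hy'⟩ := key2 y hy
  have h4 : π * ((M.det * e) ^ 2 * k) = π * (π * (x' * y' * w)) := by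
    calc π * ((M.det * e) ^ 2 * k) = (M.det * e) ^ 2 * (π * k) := by ring
      _ = (M.det * (e * x)) * (M.det * (e * y)) * w := by rw [h]; ring
      _ = _ := by rw [hx', hy']; ring
  have h5 := congrArg ψ (mul_left_cancel₀ hπ0 h4)
  simp only [map_mul, map_pow, hM.2, he1, hπψ, zero_mul, one_mul, one_pow] at h5
  exact hk h5

lemma aux_place {L E : Type*} [Field L] [IsAlgClosed L] [Field E] [Algebra (Polynomial L) E]
    (hinj : Function.Injective (algebraMap (Polynomial L) E)) (u0 : L) :
    ∃ ψ : integralClosure (Polynomial L) E →+* L,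
      ∀ p, ψ (algebraMap (Polynomial L) _ p) = p.eval u0 := by
  let B := integralClosure (Polynomial L) E
  let P : Ideal (Polynomial L) := RingHom.ker (Polynomial.evalRingHom u0)
  have hsurj : Function.Surjective (Polynomial.evalRingHom u0) := fun a => ⟨Polynomial.C a, by simp⟩
  have : P.IsMaximal := RingHom.ker_isMaximal_of_surjective _ hsurj
  have hinjB : Function.Injective (algebraMap (Polynomial L) B) := by
    intro x y hxy
    apply hinj
    have := congrArg (algebraMap B E) hxy
    simpa only [← IsScalarTower.algebraMap_apply] using this
  obtain ⟨Q, hQ, hQP⟩ := Ideal.exists_ideal_over_maximal_of_isIntegral (S := B) P (by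
    rw [(RingHom.injective_iff_ker_eq_bot _).mp hinjB]; exact bot_le)
  let m : B →+* B ⧸ Q := Ideal.Quotient.mk Q
  let j : L →+* B ⧸ Q := m.comp ((algebraMap (Polynomial L) B).comp Polynomial.C)
  have hjp : ∀ p : Polynomial L, m (algebraMap (Polynomial L) B p) = j (p.eval u0) := by
    intro p
    have : p - Polynomial.C (p.eval u0) ∈ P := by
      rw [RingHom.mem_ker]; simp
    rw [← hQP, Ideal.mem_comap, map_sub] at this
    exact (Ideal.Quotient.mk_eq_mk_iff_sub_mem _ _).mpr this
  let : Field (B ⧸ Q) := Ideal.Quotient.field Q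
  let : Algebra L (B ⧸ Q) := j.toAlgebra
  have : Algebra.IsIntegral L (B ⧸ Q) := by
    constructor
    intro x
    obtain ⟨b, rfl⟩ := Ideal.Quotient.mk_surjective x
    obtain ⟨q, hq, hqb⟩ := Algebra.IsIntegral.isIntegral (R := Polynomial L) b
    refine ⟨q.map (Polynomial.evalRingHom u0), hq.map _, ?_⟩
    rw [Polynomial.eval₂_map]
    have h2 : (algebraMap L (B ⧸ Q)).comp (Polynomial.evalRingHom u0)
        = m.comp (algebraMap (Polynomial L) B) := by
      ext p
      · exact (hjp _).symm
      · exact (hjp _).symm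
    rw [h2]
    show Polynomial.eval₂ (m.comp (algebraMap (Polynomial L) B)) (m b) q = 0
    rw [← Polynomial.hom_eval₂, hqb, map_zero]
  have hbij : Function.Bijective j :=
    IsAlgClosed.algebraMap_bijective_of_isIntegral (k := L) (K := B ⧸ Q)
  let e := RingEquiv.ofBijective j hbij
  refine ⟨(e.symm : (B ⧸ Q) →+* L).comp m, fun p => ?_⟩
  show e.symm (m (algebraMap (Polynomial L) B p)) = _
  rw [hjp]
  exact e.symm_apply_apply _

lemma aux_funext {E : Type*} [Field E] [Infinite E] {p q : Polynomial E}
    (h : ∀ e, p.eval e = q.eval e) : p = q := Polynomial.funext h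

lemma aux_integral {L E : Type*} [Field L] [Field E] [Infinite E] [Algebra (Polynomial L) E]
    (hinj : Function.Injective (algebraMap (Polynomial L) E))
    (F : MvPolynomial (Fin 3) L) (v0 v1 : Fin 3 → Polynomial L) (c0 : L) (hc0 : c0 ≠ 0)
    {d : ℕ} (z : Fin d → E)
    (h : ∀ e : E, eval₂ ((algebraMap (Polynomial L) E).comp Polynomial.C)
      (fun k => algebraMap _ E (v0 k) + e * algebraMap _ E (v1 k)) F =
      algebraMap _ E (Polynomial.C c0) * ∏ i, (e - z i)) (i : Fin d) :
    IsIntegral (Polynomial L) (z i) := by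
  let Q : Polynomial (Polynomial L) := eval₂ (Polynomial.C.comp Polynomial.C)
    (fun k => Polynomial.C (v0 k) + Polynomial.X * Polynomial.C (v1 k)) F
  have hev : ∀ e : E, Polynomial.eval₂ (algebraMap _ E) e Q =
      algebraMap _ E (Polynomial.C c0) * ∏ i, (e - z i) := by
    intro e
    rw [← h e]
    have := MvPolynomial.hom_eval₂ F (Polynomial.C.comp Polynomial.C)
      (Polynomial.eval₂RingHom (algebraMap (Polynomial L) E) e)
      (fun k => Polynomial.C (v0 k) + Polynomial.X * Polynomial.C (v1 k))
    rw [Polynomial.coe_eval₂RingHom] at this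
    rw [this]
    congr 1
    · ext a; simp
    · funext k; simp; ring
  have hc1 : Polynomial.C (c0⁻¹) * Polynomial.C c0 = 1 := by
    rw [← Polynomial.C_mul, inv_mul_cancel₀ hc0, Polynomial.C_1]
  refine ⟨Polynomial.C (Polynomial.C c0⁻¹) * Q, ?_, ?_⟩
  · rw [Function.Injective.monic_map_iff hinj]
    have : (Polynomial.C (Polynomial.C c0⁻¹) * Q).map (algebraMap _ E)
        = ∏ i, (Polynomial.X - Polynomial.C (z i)) := by
      apply Polynomial.funext
      intro e
      rw [Polynomial.eval_map, Polynomial.eval₂_mul, hev, Polynomial.eval₂_C, ← mul_assoc, ← map_mul,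
        hc1, map_one, one_mul, Polynomial.eval_prod]
      simp
    rw [this]
    exact Polynomial.monic_prod_of_monic _ _ fun i _ => Polynomial.monic_X_sub_C _
  · rw [Polynomial.eval₂_mul, hev, Finset.prod_eq_zero (Finset.mem_univ i) (sub_self _), mul_zero,
      mul_zero]

lemma aux_factor {L E : Type*} [Field L] [Field E] [Algebra (Polynomial L) E]
    (F : MvPolynomial (Fin 3) L) (v0 v1 : Fin 3 → Polynomial L) (c0 : L)
    {d : ℕ} (z : Fin d → integralClosure (Polynomial L) E)
    (h : ∀ e : E, eval₂ ((algebraMap (Polynomial L) E).comp Polynomial.C)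
      (fun k => algebraMap _ E (v0 k) + e * algebraMap _ E (v1 k)) F =
      algebraMap _ E (Polynomial.C c0) * ∏ i, (e - z i)) 
    (u0 : L) (ψ : integralClosure (Polynomial L) E →+* L)
    (hψ : ∀ p, ψ (algebraMap (Polynomial L) _ p) = p.eval u0) (e : L) :
    eval (fun k => (v0 k).eval u0 + e * (v1 k).eval u0) F = c0 * ∏ i, (e - ψ (z i)) := by
  let a : Polynomial L →+* integralClosure (Polynomial L) E :=
    algebraMap (Polynomial L) (integralClosure (Polynomial L) E)
  have hB : eval₂ (a.comp Polynomial.C)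
      (fun k => a (v0 k) + a (Polynomial.C e) * a (v1 k)) F =
      a (Polynomial.C c0) * ∏ i, (a (Polynomial.C e) - z i) := by
    have hinj : Function.Injective (algebraMap (integralClosure (Polynomial L) E) E) := Subtype.coe_injective
    apply hinj
    have h1 := h (algebraMap _ E (Polynomial.C e))
    rw [MvPolynomial.hom_eval₂, map_mul, map_prod]
    exact h1
  have h2 := congrArg ψ hB
  rw [MvPolynomial.hom_eval₂, map_mul, map_prod] at h2
  have hψa : ∀ p, ψ (a p) = p.eval u0 := hψ
  simp only [map_sub, hψa, Polynomial.eval_C] at h2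
  rw [← h2, MvPolynomial.eval, MvPolynomial.coe_eval₂Hom]
  congr 1
  · ext x; simp [hψa]
  · funext k; simp [hψa]

lemma aux_sq_dvd {L : Type*} [Field L] {d : ℕ} (v : Fin d → L) (c : L) {i j : Fin d} (hij : i ≠ j)
    (h : v i = v j) : (Polynomial.X - Polynomial.C (v i)) ^ 2 ∣
      Polynomial.C c * ∏ k, (Polynomial.X - Polynomial.C (v k)) := by
  have := Finset.prod_dvd_prod_of_subset {i, j} Finset.univ
    (fun k => Polynomial.X - Polynomial.C (v k)) (Finset.subset_univ _)
  rw [Finset.prod_pair hij, ← h, ← sq] at this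
  exact Dvd.dvd.mul_left this _

lemma aux_cube_dvd {L : Type*} [Field L] {d : ℕ} (v : Fin d → L) (c : L) {i j k : Fin d}
    (hij : i ≠ j) (hik : i ≠ k) (hjk : j ≠ k)
    (h : v i = v j) (h' : v i = v k) : (Polynomial.X - Polynomial.C (v i)) ^ 3 ∣
      Polynomial.C c * ∏ k, (Polynomial.X - Polynomial.C (v k)) := by
  have := Finset.prod_dvd_prod_of_subset {i, j, k} Finset.univ
    (fun k => Polynomial.X - Polynomial.C (v k)) (Finset.subset_univ _)
  rw [Finset.prod_insert (by simp [hij, hik]), Finset.prod_pair hjk, ← h, ← h'] at this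
  refine Dvd.dvd.mul_left ?_ _
  convert this using 1
  ring

lemma aux_infinity {L E : Type*} [Field L] [IsAlgClosed L] [Field E] [Infinite E]
    [Algebra (Polynomial L) E]
    (hinj : Function.Injective (algebraMap (Polynomial L) E))
    (F : MvPolynomial (Fin 3) L) (α β c0 : L) (hc0 : c0 ≠ 0)
    (hinf : ∀ a, ¬ ((Polynomial.X - Polynomial.C a) ^ 2 ∣ lineQinf F α β))
    {d : ℕ} (y : Fin d → E)
    (h : ∀ e : E, eval₂ ((algebraMap (Polynomial L) E).comp Polynomial.C)
      (fun k => algebraMap _ E ((![0, 1, Polynomial.X] : Fin 3 → Polynomial L) k) +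
        e * algebraMap _ E ((![1, - Polynomial.C α, Polynomial.C β] : Fin 3 → Polynomial L) k)) F =
      algebraMap _ E (Polynomial.C c0) * ∏ i, (e - y i)) :
    Function.Injective y ∧ ∀ (S : Finset (Fin d × Fin d)) (c : L) (N : ℕ),
      (∀ s ∈ S, s.1 ≠ s.2) → ∏ s ∈ S, (y s.1 - y s.2) =
        algebraMap _ E (Polynomial.C c * Polynomial.X ^ N) → N = 0 := by
  have hintegral := aux_integral hinj F _ _ c0 hc0 y h
  obtain ⟨ψ, hψ⟩ := aux_place hinj (0 : L)
  let z : Fin d → integralClosure (Polynomial L) E := fun i => ⟨y i, hintegral i⟩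
  have hfac := aux_factor F _ _ c0 z h 0 ψ hψ
  have hQ : lineQinf F α β =
      Polynomial.C c0 * ∏ i, (Polynomial.X - Polynomial.C (ψ (z i))) := by
    apply Polynomial.funext
    intro e
    rw [aux_lineQinf_eval, Polynomial.eval_mul, Polynomial.eval_C, Polynomial.eval_prod]
    simp only [Polynomial.eval_sub, Polynomial.eval_X, Polynomial.eval_C]
    rw [← hfac e]
    congr 2
    funext k
    fin_cases k
    · simp
    · simp; ring
    · simp; ring
  have hψinj : ∀ i j, i ≠ j → ψ (z i) ≠ ψ (z j) := by
    intro i j hij hh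
    apply hinf (ψ (z i))
    rw [hQ]
    exact aux_sq_dvd (fun i => ψ (z i)) c0 hij hh
  refine ⟨?_, ?_⟩
  · intro i j hij
    by_contra hne
    exact hψinj i j hne (congrArg ψ (Subtype.ext hij))
  · intro S c N hS hprod
    by_contra hN
    have h1 : ∏ s ∈ S, (z s.1 - z s.2) =
        algebraMap (Polynomial L) _ (Polynomial.C c * Polynomial.X ^ N) := by
      apply Subtype.coe_injective
      have h2 : ((∏ s ∈ S, (z s.1 - z s.2) : integralClosure (Polynomial L) E) : E)
          = ∏ s ∈ S, (y s.1 - y s.2) := by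
        show algebraMap (integralClosure (Polynomial L) E) E _ = _
        rw [map_prod]
        rfl
      exact h2.trans hprod
    have h3 := congrArg ψ h1
    rw [hψ, map_prod] at h3
    simp only [Polynomial.eval_mul, Polynomial.eval_pow, Polynomial.eval_X, zero_pow hN, mul_zero,
      map_sub] at h3
    obtain ⟨s, hs, hs0⟩ := Finset.prod_eq_zero_iff.mp h3
    exact hψinj _ _ (hS s hs) (sub_eq_zero.mp hs0)

lemma aux_perm_two {d : ℕ} {i j : Fin d} (hij : i ≠ j) (π : Equiv.Perm (Fin d))
    (h : ∀ k, k ≠ i → k ≠ j → π k = k) : π = 1 ∨ π = Equiv.swap i j := by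
  classical
  have hi : π i = i ∨ π i = j := by
    by_contra hc
    push Not at hc
    have := h (π i) hc.1 hc.2
    exact hc.1 (π.injective this)
  have hj : π j = i ∨ π j = j := by
    by_contra hc
    push Not at hc
    have := h (π j) hc.1 hc.2
    exact hc.2 (π.injective this)
  rcases hi with hi | hi
  · left
    have hj' : π j = j := by
      rcases hj with hj | hj
      · exact absurd (π.injective (hi.trans hj.symm)) hij
      · exact hj
    ext k
    by_cases h1 : k = i
    · subst h1; simp [hi]
    · by_cases h2 : k = j
      · subst h2; simp [hj']
      · simp [h k h1 h2]
  · right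
    have hj' : π j = i := by
      rcases hj with hj | hj
      · exact hj
      · exact absurd (π.injective (hi.trans hj.symm)) hij
    ext k
    by_cases h1 : k = i
    · subst h1; simp [hi]
    · by_cases h2 : k = j
      · subst h2; simp [hj']
      · rw [h k h1 h2, Equiv.swap_apply_of_ne_of_ne h1 h2]

lemma aux_finite_place {L Fq E : Type*} [Field L] [IsAlgClosed L] [Field Fq] [Field E]
    [Infinite E] [Algebra (Polynomial L) Fq] [IsFractionRing (Polynomial L) Fq]
    [Algebra Fq E] [Algebra (Polynomial L) E] [IsScalarTower (Polynomial L) Fq E]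
    [FiniteDimensional Fq E] [IsGalois Fq E]
    (F : MvPolynomial (Fin 3) L) (α β c0 : L) (hc0 : c0 ≠ 0) (hgood : GoodPair F α β)
    {d : ℕ} (z : Fin d → E)
    (h : ∀ e : E, eval₂ ((algebraMap (Polynomial L) E).comp Polynomial.C)
      (fun k => algebraMap _ E ((![0, Polynomial.X, 1] : Fin 3 → Polynomial L) k) +
        e * algebraMap _ E ((![1, - Polynomial.C α, Polynomial.C β] : Fin 3 → Polynomial L) k)) F =
      algebraMap _ E (Polynomial.C c0) * ∏ i, (e - z i))
    (Pm : (E ≃ₐ[Fq] E) →* Equiv.Perm (Fin d)) (hPminj : Function.Injective Pm)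
    (hPm : ∀ σ i, σ (z i) = z (Pm σ i))
    (S : Finset (Fin d × Fin d))
    (hS : ∀ s ∈ S, s.1 ≠ s.2 ∧ Equiv.swap s.1 s.2 ∉ Pm.range)
    (P : Polynomial L) (hP : ∏ s ∈ S, (z s.1 - z s.2) = algebraMap _ E P) (u0 : L) :
    P.eval u0 ≠ 0 := by
  intro hP0
  have hinj : Function.Injective (algebraMap (Polynomial L) E) := by
    rw [IsScalarTower.algebraMap_eq (Polynomial L) Fq E]
    exact (algebraMap Fq E).injective.comp (IsFractionRing.injective _ _)
  have hintegral := aux_integral hinj F _ _ c0 hc0 z h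
  obtain ⟨ψ, hψ⟩ := aux_place hinj u0
  let b : Fin d → integralClosure (Polynomial L) E := fun i => ⟨z i, hintegral i⟩
  have hfac := aux_factor F _ _ c0 b h u0 ψ hψ
  have hQ : lineQ F α β u0 =
      Polynomial.C c0 * ∏ i, (Polynomial.X - Polynomial.C (ψ (b i))) := by
    apply Polynomial.funext
    intro e
    rw [aux_lineQ_eval, Polynomial.eval_mul, Polynomial.eval_C, Polynomial.eval_prod]
    simp only [Polynomial.eval_sub, Polynomial.eval_X, Polynomial.eval_C]
    rw [← hfac e]
    congr 2
    funext k
    fin_cases k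
    · simp
    · simp; ring
    · simp; ring
  -- the pair that collides
  obtain ⟨i, j, hij, hsw, hψij⟩ : ∃ i j, i ≠ j ∧ Equiv.swap i j ∉ Pm.range ∧ ψ (b i) = ψ (b j) := by
    have h1 : ∏ s ∈ S, (b s.1 - b s.2) = algebraMap (Polynomial L) _ P := by
      apply Subtype.ext
      have h2 : ((∏ s ∈ S, (b s.1 - b s.2) : integralClosure (Polynomial L) E) : E)
          = ∏ s ∈ S, (z s.1 - z s.2) := by
        show algebraMap (integralClosure (Polynomial L) E) E _ = _
        rw [map_prod]
        rfl
      exact h2.trans hP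
    have h3 := congrArg ψ h1
    rw [hψ, map_prod, hP0] at h3
    obtain ⟨s, hs, hs0⟩ := Finset.prod_eq_zero_iff.mp h3
    rw [map_sub] at hs0
    exact ⟨s.1, s.2, (hS s hs).1, (hS s hs).2, sub_eq_zero.mp hs0⟩
  have hsq : ∀ k m, k ≠ m → ψ (b k) = ψ (b m) →
      (Polynomial.X - Polynomial.C (ψ (b k))) ^ 2 ∣ lineQ F α β u0 := by
    intro k m hkm hh
    rw [hQ]
    exact aux_sq_dvd (fun i => ψ (b i)) c0 hkm hh
  have hdir := hgood.simple_dir u0 _ (hsq i j hij hψij)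
  have hG : ∀ σ : E ≃ₐ[Fq] E, σ ≠ 1 →
      ∃ x : integralClosure (Polynomial L) E, ψ (σ • x) ≠ ψ x := by
    intro σ hσ
    by_contra hc
    push Not at hc
    have hfix : ∀ k, ψ (b (Pm σ k)) = ψ (b k) := by
      intro k
      rw [← hc (b k)]
      congr 1
      apply Subtype.ext
      rw [integralClosure.coe_smul]
      exact (hPm σ k).symm
    have hk : ∀ k, k ≠ i → k ≠ j → Pm σ k = k := by
      intro k hki hkj
      by_contra hne
      by_cases hka : ψ (b k) = ψ (b i)
      · apply hgood.no_triple u0 (ψ (b k))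
        rw [hQ]
        exact aux_cube_dvd (fun i => ψ (b i)) c0 hki hkj hij hka (hka.trans hψij)
      · exact hgood.no_pair u0 _ _ hka (hsq k _ (Ne.symm hne) (hfix k).symm) (hsq i j hij hψij)
    rcases aux_perm_two hij (Pm σ) hk with h1 | h1
    · exact hσ (hPminj (h1.trans (map_one Pm).symm))
    · exact hsw ⟨σ, h1⟩
  let a := ψ (b i)
  let q : Polynomial L := aeval ![Polynomial.C a, Polynomial.X - Polynomial.C (α * a),
    1 + Polynomial.C (β * a)] F
  have hqev : ∀ u, q.eval u = (lineQ F α β u).eval a := by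
    intro u
    rw [aux_lineQ_eval, aux_eval_aeval]
    congr 2
    funext k
    fin_cases k <;> simp
  have hq0 : q.eval u0 = 0 := by
    rw [hqev]
    exact (aux_dvd2 (hsq i j hij hψij)).1
  have hqd : (Polynomial.derivative q).eval u0 = eval ![a, u0 - α * a, 1 + β * a] (pderiv 1 F) := by
    rw [aux_chain]
    simp only [Polynomial.eval_add, Polynomial.eval_mul, aux_eval_aeval]
    simp
    congr 2
    funext k
    fin_cases k <;> simp
  obtain ⟨k, hk⟩ := Polynomial.dvd_iff_isRoot.mpr hq0
  have hk0 : k.eval u0 ≠ 0 := by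
    have : (Polynomial.derivative q).eval u0 = k.eval u0 := by
      rw [hk]; simp
    rw [← this, hqd]
    exact hdir
  let A : Polynomial L →+* integralClosure (Polynomial L) E := algebraMap _ _
  have hAψ : ∀ p, ψ (A p) = p.eval u0 := hψ
  have hAE : ∀ p, ((A p : integralClosure (Polynomial L) E) : E) = algebraMap _ E p := fun p => rfl
  have hAfix : ∀ (σ : E ≃ₐ[Fq] E) p, σ • A p = A p := by
    intro σ p
    apply Subtype.ext
    rw [integralClosure.coe_smul, hAE, IsScalarTower.algebraMap_apply (Polynomial L) Fq E]
    exact σ.commutes _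
  refine aux_unram (G := E ≃ₐ[Fq] E) ψ (A.comp Polynomial.C) (fun x => by simp [hAψ])
    (A (Polynomial.X - Polynomial.C u0)) ?_ (by simp [hAψ]) ?_ hG (fun σ x => hAfix σ _)
    (A (Polynomial.C a) - b i) (A (Polynomial.C a) - b j)
    (A (Polynomial.C c0) * ∏ m ∈ (Finset.univ.erase i).erase j, (A (Polynomial.C a) - b m))
    (A k) ?_ ?_ ?_ ?_
  · intro h0
    have h1 := congrArg (algebraMap (integralClosure (Polynomial L) E) E) h0
    rw [map_zero] at h1
    exact Polynomial.X_sub_C_ne_zero u0 (hinj (h1.trans (map_zero _).symm))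
  · intro y hy hy0
    have h1 : (y : E) ∈ (⊥ : IntermediateField Fq E) := by
      rw [IsGalois.mem_bot_iff_fixed]
      intro σ
      have := congrArg (Subtype.val) (hy σ)
      rw [integralClosure.coe_smul] at this
      exact this
    obtain ⟨y1, hy1⟩ := IntermediateField.mem_bot.mp h1
    have h2 : IsIntegral (Polynomial L) y1 := by
      have h3 : IsIntegral (Polynomial L) (y : E) := y.2
      rw [← hy1] at h3
      exact (isIntegral_algebraMap_iff (algebraMap Fq E).injective).mp h3
    obtain ⟨p, hp⟩ := IsIntegrallyClosed.isIntegral_iff.mp h2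
    have hyp : y = A p := by
      apply Subtype.ext
      rw [hAE, IsScalarTower.algebraMap_apply (Polynomial L) Fq E, hp, hy1]
    rw [hyp, hAψ] at hy0
    rw [hyp]
    exact map_dvd A (Polynomial.dvd_iff_isRoot.mpr hy0)
  · simp [hAψ, a]
  · simp [hAψ, a, hψij]
  · rw [hAψ]; exact hk0
  · have h1 : A q = A (Polynomial.C c0) * ∏ m, (A (Polynomial.C a) - b m) := by
      have hinjB : Function.Injective (algebraMap (integralClosure (Polynomial L) E) E) :=
        Subtype.coe_injective
      apply hinjB
      have h2 := h (algebraMap _ E (Polynomial.C a))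
      have h3 : algebraMap (integralClosure (Polynomial L) E) E
          (A (Polynomial.C c0) * ∏ m, (A (Polynomial.C a) - b m)) =
          algebraMap _ E (Polynomial.C c0) * ∏ m, (algebraMap _ E (Polynomial.C a) - z m) := by
        rw [map_mul, map_prod]
        rfl
      refine Eq.trans ?_ (h2.trans h3.symm)
      show algebraMap (Polynomial L) E q = _
      simp only [q]
      rw [MvPolynomial.aeval_def, MvPolynomial.hom_eval₂]
      congr 1
      funext m
      fin_cases m
      · simp
      · simp; ring
      · simp; ring
    rw [← map_mul, ← hk, h1, ← Finset.mul_prod_erase _ _ (Finset.mem_univ i),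
      ← Finset.mul_prod_erase (Finset.univ.erase i) _
        (Finset.mem_erase.mpr ⟨Ne.symm hij, Finset.mem_univ j⟩)]
    ring

lemma aux_inf_alg {L E : Type*} [Field L] [IsAlgClosed L] [Field E] [Infinite E]
    [Algebra (Polynomial L) E]
    (hinj : Function.Injective (algebraMap (Polynomial L) E))
    (F : MvPolynomial (Fin 3) L) (α β c0 : L) (hc0 : c0 ≠ 0)
    (hinf : ∀ a, ¬ ((Polynomial.X - Polynomial.C a) ^ 2 ∣ lineQinf F α β))
    {d : ℕ} (hF : F.IsHomogeneous d) (z : Fin d → E)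
    (h : ∀ e : E, eval₂ ((algebraMap (Polynomial L) E).comp Polynomial.C)
      (fun k => algebraMap _ E ((![0, Polynomial.X, 1] : Fin 3 → Polynomial L) k) +
        e * algebraMap _ E ((![1, - Polynomial.C α, Polynomial.C β] : Fin 3 → Polynomial L) k)) F =
      algebraMap _ E (Polynomial.C c0) * ∏ i, (e - z i)) :
    Function.Injective z ∧ ∀ (S : Finset (Fin d × Fin d)) (c : L),
      (∀ s ∈ S, s.1 ≠ s.2) → ∏ s ∈ S, (z s.1 - z s.2) =
        algebraMap _ E (Polynomial.C c) → S = ∅ := by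
  let c : L →+* E := (algebraMap (Polynomial L) E).comp Polynomial.C
  let U : E := algebraMap (Polynomial L) E Polynomial.X
  have hU : U ≠ 0 := by
    intro h0
    exact Polynomial.X_ne_zero (hinj (h0.trans (map_zero _).symm))
  let φ : Polynomial L →+* E := Polynomial.eval₂RingHom c U⁻¹
  have halg : ∀ p : Polynomial L, algebraMap _ E p = p.eval₂ c U := by
    intro p
    have : algebraMap (Polynomial L) E = Polynomial.eval₂RingHom c U := by
      ext <;> simp [c, U]
    rw [this]; rfl
  have hφinj : Function.Injective φ := by
    rw [injective_iff_map_eq_zero]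
    intro p hp
    have h1 : Polynomial.eval₂ c U⁻¹ p = 0 := hp
    have h2 : Polynomial.eval₂ c U p.reverse = 0 := by
      let w : Invertible U⁻¹ := invertibleOfNonzero (inv_ne_zero hU)
      have h3 := (Polynomial.eval₂_reverse_eq_zero_iff c U⁻¹ p).mpr h1
      rw [invOf_eq_inv, inv_inv] at h3
      exact h3
    rw [← halg] at h2
    have h4 := hinj (h2.trans (map_zero _).symm)
    exact Polynomial.reverse_eq_zero.mp h4
  let y : Fin d → E := fun i => z i * U⁻¹
  have hφC : ∀ a, φ (Polynomial.C a) = algebraMap _ E (Polynomial.C a) := by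
    intro a; simp [φ, c]
  have hφX : φ Polynomial.X = U⁻¹ := by simp [φ]
  have hy : ∀ e : E, eval₂ (φ.comp Polynomial.C)
      (fun k => φ ((![0, 1, Polynomial.X] : Fin 3 → Polynomial L) k) +
        e * φ ((![1, - Polynomial.C α, Polynomial.C β] : Fin 3 → Polynomial L) k)) F =
      φ (Polynomial.C c0) * ∏ i, (e - y i) := by
    intro e
    have h1 := h (U * e)
    have hcomp : φ.comp Polynomial.C = c := by ext a; exact hφC a
    rw [hcomp, hφC]
    have hh := aux_scale_eval (hF.map c) U
      (fun k => φ ((![0, 1, Polynomial.X] : Fin 3 → Polynomial L) k) +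
        e * φ ((![1, - Polynomial.C α, Polynomial.C β] : Fin 3 → Polynomial L) k))
    rw [eval_map, eval_map] at hh
    have h2 : (fun k => U * (φ ((![0, 1, Polynomial.X] : Fin 3 → Polynomial L) k) +
        e * φ ((![1, - Polynomial.C α, Polynomial.C β] : Fin 3 → Polynomial L) k))) =
        (fun k => algebraMap _ E ((![0, Polynomial.X, 1] : Fin 3 → Polynomial L) k) +
        U * e * algebraMap _ E ((![1, - Polynomial.C α, Polynomial.C β] :
          Fin 3 → Polynomial L) k)) := by
      funext k
      fin_cases k
      · simp
      · simp [hφC, U]; ring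
      · simp [hφC, hφX, mul_add, mul_inv_cancel₀ hU]; ring
    rw [h2] at hh
    have h3 : U ^ d * (algebraMap _ E (Polynomial.C c0) * ∏ i, (e - y i)) =
        algebraMap _ E (Polynomial.C c0) * ∏ i, (U * e - z i) := by
      have : ∏ i, (U * e - z i) = U ^ d * ∏ i, (e - y i) := by
        have h5 : U ^ d = ∏ i : Fin d, U := by simp
        rw [h5, ← Finset.prod_mul_distrib]
        refine Finset.prod_congr rfl fun i _ => ?_
        simp only [y]
        field_simp
      rw [this]; ring
    apply mul_left_cancel₀ (pow_ne_zero d hU)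
    rw [h3, ← h1]
    exact hh.symm
  have main := @aux_infinity L E _ _ _ _ φ.toAlgebra hφinj F α β c0 hc0 hinf d y hy
  refine ⟨?_, ?_⟩
  · intro i j hij
    apply main.1
    simp only [y, hij]
  · intro S a hS hprod
    rw [← Finset.card_eq_zero]
    refine main.2 S a S.card hS ?_
    show _ = φ _
    rw [map_mul, map_pow, hφX, hφC, ← hprod, ← Finset.prod_const, ← Finset.prod_mul_distrib]
    refine Finset.prod_congr rfl fun s _ => ?_
    simp only [y]
    ring

lemma aux_galois {L Fq E : Type*} [Field L] [IsAlgClosed L] [Field Fq] [Field E]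
    [Infinite E] [Algebra (Polynomial L) Fq] [IsFractionRing (Polynomial L) Fq]
    [Algebra Fq E] [Algebra (Polynomial L) E] [IsScalarTower (Polynomial L) Fq E]
    [FiniteDimensional Fq E] [IsGalois Fq E]
    (F : MvPolynomial (Fin 3) L) (α β c0 : L) (hc0 : c0 ≠ 0) (hgood : GoodPair F α β)
    {d : ℕ} (hF : F.IsHomogeneous d) (z : Fin d → E)
    (h : ∀ e : E, eval₂ ((algebraMap (Polynomial L) E).comp Polynomial.C)
      (fun k => algebraMap _ E ((![0, Polynomial.X, 1] : Fin 3 → Polynomial L) k) +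
        e * algebraMap _ E ((![1, - Polynomial.C α, Polynomial.C β] : Fin 3 → Polynomial L) k)) F =
      algebraMap _ E (Polynomial.C c0) * ∏ i, (e - z i))
    (hfaith : ∀ σ : E ≃ₐ[Fq] E, (∀ i, σ (z i) = z i) → σ = 1) :
    Nonempty ((E ≃ₐ[Fq] E) ≃* Equiv.Perm (Fin d)) := by
  classical
  have hinj : Function.Injective (algebraMap (Polynomial L) E) := by
    rw [IsScalarTower.algebraMap_eq (Polynomial L) Fq E]
    exact (algebraMap Fq E).injective.comp (IsFractionRing.injective _ _)
  have hinf := aux_inf_alg hinj F α β c0 hc0 hgood.infty hF z h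
  have hzinj := hinf.1
  have hσalg : ∀ (σ : E ≃ₐ[Fq] E) p, σ (algebraMap (Polynomial L) E p) = algebraMap _ E p := by
    intro σ p
    rw [IsScalarTower.algebraMap_apply (Polynomial L) Fq E]
    exact σ.commutes _
  have hex : ∀ (σ : E ≃ₐ[Fq] E) i, ∃ j, σ (z i) = z j := by
    intro σ i
    have h1 := congrArg σ (h (z i))
    rw [Finset.prod_eq_zero (Finset.mem_univ i) (sub_self _), mul_zero, map_zero] at h1
    have h2 := h (σ (z i))
    have h3 : σ (eval₂ ((algebraMap (Polynomial L) E).comp Polynomial.C)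
      (fun k => algebraMap _ E ((![0, Polynomial.X, 1] : Fin 3 → Polynomial L) k) +
        z i * algebraMap _ E ((![1, - Polynomial.C α, Polynomial.C β] :
          Fin 3 → Polynomial L) k)) F) =
        eval₂ ((algebraMap (Polynomial L) E).comp Polynomial.C)
      (fun k => algebraMap _ E ((![0, Polynomial.X, 1] : Fin 3 → Polynomial L) k) +
        σ (z i) * algebraMap _ E ((![1, - Polynomial.C α, Polynomial.C β] :
          Fin 3 → Polynomial L) k)) F := by
      have h4 := MvPolynomial.hom_eval₂ F ((algebraMap (Polynomial L) E).comp Polynomial.C)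
        (σ : E →+* E) (fun k => algebraMap _ E ((![0, Polynomial.X, 1] : Fin 3 → Polynomial L) k) +
        z i * algebraMap _ E ((![1, - Polynomial.C α, Polynomial.C β] :
          Fin 3 → Polynomial L) k))
      refine h4.trans ?_
      congr 1
      · ext a
        simp [hσalg]
      · funext k
        simp [hσalg]
    rw [← h3, h1] at h2
    have h5 : ∏ k, (σ (z i) - z k) = 0 := by
      rcases mul_eq_zero.mp h2.symm with h6 | h6
      · exfalso
        apply hc0
        have := hinj (h6.trans (map_zero _).symm)
        simpa using this
      · exact h6
    obtain ⟨k, _, hk⟩ := Finset.prod_eq_zero_iff.mp h5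
    exact ⟨k, sub_eq_zero.mp hk⟩
  choose pf hpf using hex
  let Pe : (E ≃ₐ[Fq] E) →* Function.End (Fin d) :=
    { toFun := fun σ => pf σ
      map_one' := by
        funext i
        apply hzinj
        rw [← hpf]; rfl
      map_mul' := by
        intro σ τ
        funext i
        apply hzinj
        rw [← hpf]
        show σ (τ (z i)) = z (pf σ (pf τ i))
        rw [← hpf, ← hpf] }
  let Pm : (E ≃ₐ[Fq] E) →* Equiv.Perm (Fin d) := Pe.toHomPerm
  have hPm : ∀ σ i, σ (z i) = z (Pm σ i) := fun σ i => hpf σ i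
  have hPminj : Function.Injective Pm := by
    rw [injective_iff_map_eq_one]
    intro σ hσ
    apply hfaith
    intro i
    rw [hPm, hσ]; rfl
  let S : Finset (Fin d × Fin d) :=
    Finset.univ.filter fun s => s.1 ≠ s.2 ∧ Equiv.swap s.1 s.2 ∉ Pm.range
  have hS : ∀ s ∈ S, s.1 ≠ s.2 ∧ Equiv.swap s.1 s.2 ∉ Pm.range := by
    intro s hs
    exact (Finset.mem_filter.mp hs).2
  have hSinv : ∀ σ (s : Fin d × Fin d), s ∈ S → (Pm σ s.1, Pm σ s.2) ∈ S := by
    intro σ s hs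
    obtain ⟨h1, h2⟩ := hS s hs
    refine Finset.mem_filter.mpr ⟨Finset.mem_univ _, fun hh => h1 ((Pm σ).injective hh), ?_⟩
    intro hh
    apply h2
    have h3 : Equiv.swap s.1 s.2 = (Pm σ)⁻¹ * Equiv.swap (Pm σ s.1) (Pm σ s.2) * Pm σ := by
      rw [mul_assoc, ← Equiv.mul_swap_eq_swap_mul, inv_mul_cancel_left]
    rw [h3]
    exact Pm.range.mul_mem (Pm.range.mul_mem (Pm.range.inv_mem ⟨σ, rfl⟩) hh) ⟨σ, rfl⟩
  have hfixed : ∀ σ : E ≃ₐ[Fq] E, σ (∏ s ∈ S, (z s.1 - z s.2)) = ∏ s ∈ S, (z s.1 - z s.2) := by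
    intro σ
    rw [map_prod]
    refine Finset.prod_bij (fun s _ => (Pm σ s.1, Pm σ s.2)) (hSinv σ) ?_ ?_ ?_
    · intro s _ t _ hst
      rw [Prod.mk.injEq] at hst
      exact Prod.ext ((Pm σ).injective hst.1) ((Pm σ).injective hst.2)
    · intro s hs
      refine ⟨(Pm σ⁻¹ s.1, Pm σ⁻¹ s.2), hSinv _ s hs, ?_⟩
      simp
    · intro s _
      rw [map_sub, hPm, hPm]
  have hintegral := aux_integral hinj F _ _ c0 hc0 z h
  obtain ⟨P, hP⟩ : ∃ P : Polynomial L, ∏ s ∈ S, (z s.1 - z s.2) = algebraMap _ E P := by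
    have h1 : ∏ s ∈ S, (z s.1 - z s.2) ∈ (⊥ : IntermediateField Fq E) := by
      rw [IsGalois.mem_bot_iff_fixed]
      exact hfixed
    obtain ⟨y1, hy1⟩ := IntermediateField.mem_bot.mp h1
    have h2 : IsIntegral (Polynomial L) y1 := by
      have h3 : IsIntegral (Polynomial L) (∏ s ∈ S, (z s.1 - z s.2)) :=
        IsIntegral.prod _ fun s _ => (hintegral s.1).sub (hintegral s.2)
      rw [← hy1] at h3
      exact (isIntegral_algebraMap_iff (algebraMap Fq E).injective).mp h3
    obtain ⟨p, hp⟩ := IsIntegrallyClosed.isIntegral_iff.mp h2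
    exact ⟨p, by rw [← hy1, ← hp, ← IsScalarTower.algebraMap_apply]⟩
  have hroot := aux_finite_place F α β c0 hc0 hgood z h Pm hPminj hPm S hS P hP
  have hdeg : P.degree = 0 := by
    by_contra hne
    obtain ⟨x, hx⟩ := IsAlgClosed.exists_root P hne
    exact hroot x hx
  rw [Polynomial.eq_C_of_degree_eq_zero hdeg] at hP
  have hempty := hinf.2 S _ (fun s hs => (hS s hs).1) hP
  have htop : Pm.range = ⊤ := by
    rw [eq_top_iff, ← Equiv.Perm.closure_isSwap, Subgroup.closure_le]
    rintro σ ⟨i, j, hij, rfl⟩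
    by_contra hc
    have : (i, j) ∈ S := Finset.mem_filter.mpr ⟨Finset.mem_univ _, hij, hc⟩
    rw [hempty] at this
    exact absurd this (Finset.notMem_empty _)
  exact ⟨MulEquiv.ofBijective Pm ⟨hPminj, MonoidHom.range_eq_top.mp htop⟩⟩

lemma aux_lin_coeff {L k : Type*} [Field L] [Field k] (a : L →+* k) {F : MvPolynomial (Fin 3) L}
    {d : ℕ} (hF : F.IsHomogeneous d) (A B : Fin 3 → k) :
    (eval₂ (Polynomial.C.comp a)
      (fun i => Polynomial.C (A i) + Polynomial.X * Polynomial.C (B i)) F).natDegree ≤ d ∧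
    (eval₂ (Polynomial.C.comp a)
      (fun i => Polynomial.C (A i) + Polynomial.X * Polynomial.C (B i)) F).coeff d
      = eval₂ a B F := by
  have hw : ∀ i, (Polynomial.C (A i) + Polynomial.X * Polynomial.C (B i)).natDegree ≤ 1 := by
    intro i
    rw [add_comm, mul_comm]
    exact Polynomial.natDegree_linear_le
  have hwp : ∀ i n, ((Polynomial.C (A i) + Polynomial.X * Polynomial.C (B i)) ^ n).natDegree ≤ n := by
    intro i n
    have := Polynomial.natDegree_pow_le_of_le n (hw i)
    simpa using this
  have hwc : ∀ i n, ((Polynomial.C (A i) + Polynomial.X * Polynomial.C (B i)) ^ n).coeff n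
      = B i ^ n := by
    intro i n
    have := Polynomial.coeff_pow_of_natDegree_le (m := n) (hw i)
    rw [mul_one] at this
    rw [this]
    congr 1
    simp [Polynomial.coeff_C]
  have hm : ∀ m ∈ F.support, m 0 + m 1 + m 2 = d := by
    intro m hm
    have := hF.degree_eq_sum_deg_support hm
    rw [this, ← Finsupp.degree_apply, Finsupp.degree_eq_sum, Fin.sum_univ_three]
  rw [eval₂_eq', eval₂_eq']
  constructor
  · refine Polynomial.natDegree_sum_le_of_forall_le _ _ fun m hms => ?_
    rw [← hm m hms, Fin.prod_univ_three]
    refine (Polynomial.natDegree_C_mul_le _ _).trans ?_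
    exact Polynomial.natDegree_mul_le_of_le (Polynomial.natDegree_mul_le_of_le (hwp _ _) (hwp _ _))
      (hwp _ _)
  · rw [Polynomial.finset_sum_coeff]
    refine Finset.sum_congr rfl fun m hms => ?_
    rw [RingHom.comp_apply, Polynomial.coeff_C_mul, Fin.prod_univ_three, Fin.prod_univ_three]
    congr 1
    conv_lhs => rw [← hm m hms]
    rw [Polynomial.coeff_mul_add_eq_of_natDegree_le
      (Polynomial.natDegree_mul_le_of_le (hwp _ _) (hwp _ _)) (hwp _ _),
      Polynomial.coeff_mul_add_eq_of_natDegree_le (hwp _ _) (hwp _ _), hwc, hwc, hwc]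

lemma aux_roots_fin {E : Type*} [Field E] {p : Polynomial E} (hp : p.Splits) {d : ℕ}
    (hd : p.natDegree = d) : ∃ t : Fin d → E,
      p = Polynomial.C p.leadingCoeff * ∏ i, (Polynomial.X - Polynomial.C (t i)) := by
  have h1 := hp.eq_prod_roots
  have h2 := hp.natDegree_eq_card_roots
  obtain ⟨l, hl⟩ := Quot.exists_rep p.roots
  have hl' : p.roots = (l : Multiset E) := hl.symm
  rw [hl'] at h1 h2
  rw [hd] at h2
  have h3 : d = l.length := by simpa using h2
  subst h3
  refine ⟨fun i => l[i], ?_⟩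
  conv_lhs => rw [h1]
  congr 1
  rw [Multiset.map_coe, Multiset.prod_coe, ← Fin.prod_univ_getElem]
  rw [← List.prod_ofFn, ← List.prod_ofFn]
  congr 1
  apply List.ext_getElem <;> simp

lemma aux_to_galois_abs {L Fq E : Type*} [Field L] [IsAlgClosed L] [Field Fq] [Field E]
    [Algebra (Polynomial L) Fq] [IsFractionRing (Polynomial L) Fq]
    [Algebra Fq E] [Algebra (Polynomial L) E] [IsScalarTower (Polynomial L) Fq E]
    (F : MvPolynomial (Fin 3) L) (α β : L) (hgood : GoodPair F α β)
    {d : ℕ} (hF : F.IsHomogeneous d)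
    (htop : (aeval ![0, Polynomial.X, 1] F : Polynomial L) ≠ 0)
    (a : L →+* Fq) (ha : a = (algebraMap (Polynomial L) Fq).comp Polynomial.C)
    (u : Fq) (hu : u = algebraMap (Polynomial L) Fq Polynomial.X)
    (g : Polynomial Fq)
    (hg : g = Polynomial.C (u ^ d) * eval₂ (Polynomial.C.comp a)
      (fun i => Polynomial.C ((![1, 0, a α * u⁻¹ + a β] : Fin 3 → Fq) i) +
        Polynomial.X * Polynomial.C ((![0, 1, u⁻¹] : Fin 3 → Fq) i)) F)
    (hspl : Polynomial.IsSplittingField Fq E g) :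
    Nonempty ((E ≃ₐ[Fq] E) ≃* Equiv.Perm (Fin d)) := by
  have hFinj : Function.Injective (algebraMap (Polynomial L) Fq) := IsFractionRing.injective _ _
  have hu0 : u ≠ 0 := by
    rw [hu]
    intro h0
    exact Polynomial.X_ne_zero (hFinj (h0.trans (map_zero _).symm))
  obtain ⟨hd1, hd2⟩ := aux_lin_coeff a hF ![1, 0, a α * u⁻¹ + a β] ![0, 1, u⁻¹]
  have hlead : u ^ d * eval₂ a ![0, 1, u⁻¹] F ≠ 0 := by
    have h1 := aux_scale_eval (hF.map a) u ![0, 1, u⁻¹]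
    rw [eval_map, eval_map] at h1
    rw [← h1]
    intro h2
    apply htop
    apply hFinj
    rw [map_zero, ← h2, aeval_def, hom_eval₂]
    congr 1
    · rw [ha]; rfl
    · funext i
      fin_cases i
      · simp
      · simp [hu]
      · simp [hu0]
  have hcoeff : g.coeff d = u ^ d * eval₂ a ![0, 1, u⁻¹] F := by
    rw [hg, Polynomial.coeff_C_mul, hd2]
  have hgdeg : g.natDegree = d := by
    apply le_antisymm
    · rw [hg]
      exact (Polynomial.natDegree_C_mul_le _ _).trans hd1
    · apply Polynomial.le_natDegree_of_ne_zero
      rw [hcoeff]; exact hlead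
  let ι : Fq →+* E := algebraMap Fq E
  let U : E := ι u
  have hU0 : U ≠ 0 := (map_ne_zero ι).mpr hu0
  let c : L →+* E := ι.comp a
  obtain ⟨t, ht⟩ := aux_roots_fin (Polynomial.IsSplittingField.splits E g)
    ((Polynomial.natDegree_map (algebraMap Fq E)).trans hgdeg)
  let ℓ : E := (g.map ι).leadingCoeff
  have hℓ : ℓ ≠ 0 := by
    apply Polynomial.leadingCoeff_ne_zero.mpr
    apply (Polynomial.map_ne_zero_iff ι.injective).mpr
    intro h0
    rw [← hcoeff, h0] at hlead
    simp at hlead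
  have hgev : ∀ e : E, (g.map ι).eval e =
      U ^ d * eval₂ c ![1, e, (c α + e) * U⁻¹ + c β] F := by
    intro e
    rw [Polynomial.eval_map, hg, Polynomial.eval₂_mul, Polynomial.eval₂_C, map_pow]
    congr 1
    have := MvPolynomial.hom_eval₂ F (Polynomial.C.comp a)
      (Polynomial.eval₂RingHom ι e)
      (fun i => Polynomial.C ((![1, 0, a α * u⁻¹ + a β] : Fin 3 → Fq) i) +
        Polynomial.X * Polynomial.C ((![0, 1, u⁻¹] : Fin 3 → Fq) i))
    rw [Polynomial.coe_eval₂RingHom] at this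
    rw [this]
    congr 1
    · ext x; simp [c]
    · funext i
      fin_cases i
      · simp
      · simp
      · simp [c, U]; ring
  have hgev2 : ∀ e : E, (g.map ι).eval e = ℓ * ∏ i, (e - t i) := by
    intro e
    have := congrArg (Polynomial.eval e) ht
    rw [Polynomial.eval_mul, Polynomial.eval_C, Polynomial.eval_prod] at this
    simp only [Polynomial.eval_sub, Polynomial.eval_X, Polynomial.eval_C] at this
    exact this
  let c0 : L := eval ![1, -α, β] F
  have hc0 : c0 ≠ 0 := hgood.center
  have hc0E : eval₂ c ![1, - c α, c β] F = c c0 := by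
    simp only [c0, eval, coe_eval₂Hom]
    rw [hom_eval₂]
    congr 1
    funext i
    fin_cases i <;> simp
  have hprodc : U ^ d * c c0 = ℓ * ∏ i, (- c α - t i) := by
    rw [← hgev2, hgev, ← hc0E]
    congr 2
    funext i
    fin_cases i <;> simp
  have hαt : ∀ i, c α + t i ≠ 0 := by
    intro i h0
    have h1 : U ^ d * c c0 = 0 := by
      rw [hprodc, Finset.prod_eq_zero (Finset.mem_univ i), mul_zero]
      linear_combination -h0
    exact mul_ne_zero (pow_ne_zero _ hU0) ((map_ne_zero c).mpr hc0) h1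
  let z : Fin d → E := fun i => U * (c α + t i)⁻¹
  have hz0 : ∀ i, z i ≠ 0 := fun i => mul_ne_zero hU0 (inv_ne_zero (hαt i))
  have hinf : Infinite E := Infinite.of_injective c c.injective
  have hQne : ∀ e : E, e ≠ 0 →
      eval₂ c ![e, U - c α * e, 1 + c β * e] F = c c0 * ∏ i, (e - z i) := by
    intro e he
    have h1 := (hgev (- c α + U * e⁻¹)).symm.trans (hgev2 _)
    have h2 := aux_scale_eval (hF.map c) e ![1, - c α + U * e⁻¹, (c α + (- c α + U * e⁻¹)) * U⁻¹ + c β]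
    rw [eval_map, eval_map] at h2
    have h3 : (fun i => e * (![1, - c α + U * e⁻¹, (c α + (- c α + U * e⁻¹)) * U⁻¹ + c β] :
        Fin 3 → E) i) = ![e, U - c α * e, 1 + c β * e] := by
      funext i
      fin_cases i
      · simp
      · simp; field_simp; ring
      · simp; field_simp
    rw [h3] at h2
    apply mul_left_cancel₀ (pow_ne_zero d hU0)
    rw [h2, ← mul_assoc (U ^ d) (c c0), hprodc]
    calc U ^ d * (e ^ d * eval₂ c ![1, - c α + U * e⁻¹, (c α + (- c α + U * e⁻¹)) * U⁻¹ + c β] F)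
        = e ^ d * (ℓ * ∏ i, (- c α + U * e⁻¹ - t i)) := by rw [← h1]; ring
      _ = ℓ * ((∏ i : Fin d, e) * ∏ i, (- c α + U * e⁻¹ - t i)) := by
          rw [Finset.prod_const, Finset.card_univ, Fintype.card_fin]; ring
      _ = ℓ * ((∏ i, (- c α - t i)) * ∏ i, (e - z i)) := by
          rw [← Finset.prod_mul_distrib, ← Finset.prod_mul_distrib]
          congr 1
          refine Finset.prod_congr rfl fun i _ => ?_
          have := hαt i
          simp only [z]
          field_simp
          ring
      _ = _ := by ring
  have hQ : ∀ e : E, eval₂ c ![e, U - c α * e, 1 + c β * e] F = c c0 * ∏ i, (e - z i) := by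
    intro e
    let q1 : Polynomial E := eval₂ (Polynomial.C.comp c)
      ![Polynomial.X, Polynomial.C U - Polynomial.C (c α) * Polynomial.X,
        1 + Polynomial.C (c β) * Polynomial.X] F
    let q2 : Polynomial E := Polynomial.C (c c0) * ∏ i, (Polynomial.X - Polynomial.C (z i))
    have e1 : ∀ e, q1.eval e = eval₂ c ![e, U - c α * e, 1 + c β * e] F := by
      intro e
      have := hom_eval₂ F (Polynomial.C.comp c) (Polynomial.evalRingHom e)
        ![Polynomial.X, Polynomial.C U - Polynomial.C (c α) * Polynomial.X,
        1 + Polynomial.C (c β) * Polynomial.X]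
      rw [Polynomial.coe_evalRingHom] at this
      simp only [q1]
      rw [this]
      congr 1
      · ext x; simp
      · funext i
        fin_cases i <;> simp
    have e2 : ∀ e, q2.eval e = c c0 * ∏ i, (e - z i) := by
      intro e
      simp [q2, Polynomial.eval_prod]
    have : q1 = q2 := by
      have h4 : Polynomial.X * q1 = Polynomial.X * q2 := by
        apply Polynomial.funext
        intro e
        rw [Polynomial.eval_mul, Polynomial.eval_mul, Polynomial.eval_X]
        by_cases he : e = 0
        · rw [he, zero_mul, zero_mul]
        · rw [e1, e2, hQne e he]
      exact mul_left_cancel₀ Polynomial.X_ne_zero h4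
    rw [← e1, ← e2, this]
  have halg : algebraMap (Polynomial L) E = ι.comp (algebraMap (Polynomial L) Fq) :=
    IsScalarTower.algebraMap_eq _ _ _
  have hinjE : Function.Injective (algebraMap (Polynomial L) E) := by
    rw [halg]
    exact ι.injective.comp hFinj
  have hcE : (algebraMap (Polynomial L) E).comp Polynomial.C = c := by
    ext x
    simp only [c, ha, halg]
    rfl
  have hcE' : ∀ x, algebraMap (Polynomial L) E (Polynomial.C x) = c x := fun x =>
    congrArg (fun f : L →+* E => f x) hcE
  have hXE : algebraMap (Polynomial L) E Polynomial.X = U := by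
    simp only [U, hu, halg]
    rfl
  have hmain : ∀ e : E, eval₂ ((algebraMap (Polynomial L) E).comp Polynomial.C)
      (fun k => algebraMap _ E ((![0, Polynomial.X, 1] : Fin 3 → Polynomial L) k) +
        e * algebraMap _ E ((![1, - Polynomial.C α, Polynomial.C β] : Fin 3 → Polynomial L) k)) F =
      algebraMap _ E (Polynomial.C c0) * ∏ i, (e - z i) := by
    intro e
    rw [hcE, hcE', ← hQ]
    congr 1
    funext i
    fin_cases i
    · simp
    · simp [hcE', hXE]; ring
    · simp [hcE']; ring
  have hzinj := (aux_inf_alg hinjE F α β c0 hc0 hgood.infty hF z hmain).1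
  have htinj : Function.Injective t := by
    intro i j hij
    apply hzinj
    simp only [z, hij]
  have hsep : g.Separable := by
    rw [← Polynomial.separable_map ι]
    have hh : g.map ι = Polynomial.C ℓ * ∏ i, (Polynomial.X - Polynomial.C (t i)) := ht
    rw [hh]
    exact (Polynomial.separable_prod_X_sub_C_iff.mpr htinj).unit_mul
      (Polynomial.isUnit_C.mpr hℓ.isUnit)
  have : IsGalois Fq E := IsGalois.of_separable_splitting_field hsep
  have : FiniteDimensional Fq E := Polynomial.IsSplittingField.finiteDimensional E g
  refine aux_galois (Fq := Fq) (E := E) F α β c0 hc0 hgood hF z hmain ?_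
  intro σ hσ
  have hσt : ∀ i, σ (t i) = t i := by
    intro i
    have hcx : ∀ x, σ (c x) = c x := fun x => σ.commutes _
    have hσU : σ U = U := σ.commutes _
    have h1 : t i = U * (z i)⁻¹ - c α := by
      have := hαt i
      simp only [z]
      field_simp
      ring
    rw [h1, map_sub, map_mul, map_inv₀, hσU, hσ, hcx]
  have hh : ∀ x ∈ g.rootSet E, (σ : E →ₐ[Fq] E) x = AlgHom.id Fq E x := by
    intro x hx
    have h1 : (g.map ι).eval x = 0 := by
      have := Polynomial.aeval_eq_zero_of_mem_rootSet hx
      rw [Polynomial.eval_map]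
      exact this
    rw [hgev2] at h1
    obtain ⟨i, _, hi⟩ := Finset.prod_eq_zero_iff.mp ((mul_eq_zero.mp h1).resolve_left hℓ)
    rw [sub_eq_zero.mp hi]
    exact hσt i
  have hid : (σ : E →ₐ[Fq] E) = AlgHom.id Fq E :=
    AlgHom.ext_of_adjoin_eq_top (Polynomial.IsSplittingField.adjoin_rootSet E g) hh
  ext x
  exact congrArg (fun f : E →ₐ[Fq] E => f x) hid

lemma aux_to_galois {L Fq : Type*} [Field L] [IsAlgClosed L] [Field Fq]
    [Algebra (Polynomial L) Fq] [IsFractionRing (Polynomial L) Fq]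
    (F : MvPolynomial (Fin 3) L) (α β : L) (hgood : GoodPair F α β)
    {d : ℕ} (hF : F.IsHomogeneous d)
    (htop : (aeval ![0, Polynomial.X, 1] F : Polynomial L) ≠ 0)
    (a : L →+* Fq) (ha : a = (algebraMap (Polynomial L) Fq).comp Polynomial.C)
    (u : Fq) (hu : u = algebraMap (Polynomial L) Fq Polynomial.X)
    (g : Polynomial Fq)
    (hg : g = Polynomial.C (u ^ d) * eval₂ (Polynomial.C.comp a)
      (fun i => Polynomial.C ((![1, 0, a α * u⁻¹ + a β] : Fin 3 → Fq) i) +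
        Polynomial.X * Polynomial.C ((![0, 1, u⁻¹] : Fin 3 → Fq) i)) F) :
    Nonempty (g.Gal ≃* Equiv.Perm (Fin d)) :=
  aux_to_galois_abs (E := g.SplittingField) F α β hgood hF htop a ha u hu g hg inferInstance

lemma aux_range_coeff {K : Type*} [Field K] (f : MvPolynomial (Fin 2) K) (d : ℕ)
    (hdeg : f.totalDegree = d) (α β : K) (k : ℕ) :
    ∃ c : Polynomial K, (lineSubU f d α β).coeff k =
      algebraMap (Polynomial (AlgebraicClosure K))
        (FractionRing (Polynomial (AlgebraicClosure K)))
        (c.map (algebraMap K (AlgebraicClosure K))) := by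
  let L := AlgebraicClosure K
  let Fq := FractionRing (Polynomial L)
  let φ : Polynomial K →+* Fq :=
    (algebraMap (Polynomial L) Fq).comp (Polynomial.mapRingHom (algebraMap K L))
  let u : Fq := algebraMap (Polynomial L) Fq Polynomial.X
  have hu0 : u ≠ 0 := by
    intro h0
    exact Polynomial.X_ne_zero (IsFractionRing.injective (Polynomial L) Fq
      (h0.trans (map_zero _).symm))
  have hφX : φ Polynomial.X = u := by simp [φ, u]
  have hφC : ∀ x : K, φ (Polynomial.C x) = algebraMap L Fq (algebraMap K L x) := by
    intro x
    simp only [φ, RingHom.comp_apply, Polynomial.coe_mapRingHom, Polynomial.map_C]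
    rw [IsScalarTower.algebraMap_apply L (Polynomial L) Fq]
    rfl
  let R : Subring (Polynomial Fq) := (Polynomial.mapRingHom φ).range
  have hRC : ∀ x, Polynomial.C (φ x) ∈ R := fun x => ⟨Polynomial.C x, by simp⟩
  have hRX : Polynomial.X ∈ R := ⟨Polynomial.X, by simp⟩
  have hmem : lineSubU f d α β ∈ R := by
    have h1 : lineSubU f d α β = Polynomial.C (u ^ d) *
        aeval ![Polynomial.X,
        Polynomial.C ((algebraMap L Fq (algebraMap K L α)) * u⁻¹ +
            algebraMap L Fq (algebraMap K L β)) +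
          Polynomial.C u⁻¹ * Polynomial.X] (f.map (algebraMap K L)) := rfl
    rw [h1, aeval_def, eval₂_map, eval₂_eq', Finset.mul_sum]
    refine Subring.sum_mem _ fun m hm => ?_
    have hle : m 0 + m 1 ≤ d := by
      have := le_totalDegree hm
      rw [hdeg, Finsupp.sum, ← Finsupp.degree_apply, Finsupp.degree_eq_sum, Fin.sum_univ_two] at this
      exact this
    have hcoef : (((algebraMap L (Polynomial Fq)).comp (algebraMap K L)) (coeff m f))
        = Polynomial.C (φ (Polynomial.C (coeff m f))) := by
      rw [hφC]
      rfl
    rw [Fin.prod_univ_two, hcoef]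
    simp only [Matrix.cons_val_zero, Matrix.cons_val_one]
    have hud : u ^ d = u ^ (d - m 1) * u ^ m 1 := by
      rw [← pow_add]; congr 1; omega
    have hW : Polynomial.C u * (Polynomial.C ((algebraMap L Fq (algebraMap K L α)) * u⁻¹ +
            algebraMap L Fq (algebraMap K L β)) + Polynomial.C u⁻¹ * Polynomial.X)
        = Polynomial.C (φ (Polynomial.C α + Polynomial.C β * Polynomial.X)) + Polynomial.X := by
      rw [map_add φ, map_mul φ, hφC, hφC, hφX, mul_add, ← mul_assoc, ← Polynomial.C_mul,
        ← Polynomial.C_mul, mul_inv_cancel₀ hu0, Polynomial.C_1, one_mul]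
      congr 2
      rw [mul_add, mul_comm u (_ * u⁻¹), mul_assoc, inv_mul_cancel₀ hu0]
      ring
    have : ∀ (c0 W : Polynomial Fq), Polynomial.C (u ^ d) * (c0 * (Polynomial.X ^ m 0 * W ^ m 1)) =
        Polynomial.C u ^ (d - m 1) * c0 * Polynomial.X ^ m 0 * (Polynomial.C u * W) ^ m 1 := by
      intro c0 W
      rw [hud, Polynomial.C_mul, Polynomial.C_pow, Polynomial.C_pow]
      ring
    rw [this, hW]
    have huR : Polynomial.C u ∈ R := hφX ▸ hRC _
    exact R.mul_mem (R.mul_mem (R.mul_mem (R.pow_mem huR _) (hRC _)) (R.pow_mem hRX _))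
      (R.pow_mem (R.add_mem (hRC _) hRX) _)
  obtain ⟨G, hG⟩ := hmem
  refine ⟨G.coeff k, ?_⟩
  rw [← hG, Polynomial.coe_mapRingHom, Polynomial.coeff_map]
  rfl

lemma aux_totalDegree_map {R S σ : Type*} [CommSemiring R] [CommSemiring S] (i : R →+* S)
    (hi : Function.Injective i) (f : MvPolynomial σ R) :
    (f.map i).totalDegree = f.totalDegree := by
  simp only [totalDegree, support_map_of_injective _ hi]

lemma aux_lineSubU_eq {K : Type*} [Field K] (f : MvPolynomial (Fin 2) K) (d : ℕ)
    (F : MvPolynomial (Fin 3) K) (hFf : aeval ![1, X 0, X 1] F = f) (α β : K)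
    (a : AlgebraicClosure K →+* FractionRing (Polynomial (AlgebraicClosure K)))
    (ha : a = (algebraMap (Polynomial (AlgebraicClosure K)) _).comp Polynomial.C)
    (u : FractionRing (Polynomial (AlgebraicClosure K)))
    (hu : u = algebraMap (Polynomial (AlgebraicClosure K)) _ Polynomial.X) :
    lineSubU f d α β = Polynomial.C (u ^ d) * eval₂ (Polynomial.C.comp a)
      (fun i => Polynomial.C ((![1, 0, a (algebraMap K _ α) * u⁻¹ + a (algebraMap K _ β)] :
        Fin 3 → FractionRing (Polynomial (AlgebraicClosure K))) i) +
        Polynomial.X * Polynomial.C ((![0, 1, u⁻¹] :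
        Fin 3 → FractionRing (Polynomial (AlgebraicClosure K))) i))
        (F.map (algebraMap K (AlgebraicClosure K))) := by
  have haa : a = algebraMap (AlgebraicClosure K) _ := by
    rw [ha, IsScalarTower.algebraMap_eq (AlgebraicClosure K) (Polynomial (AlgebraicClosure K))]
    rfl
  unfold lineSubU
  rw [← hu, ← haa]
  congr 1
  rw [aeval_def, eval₂_map, eval₂_map, ← hFf, aeval_def]
  have hc : (algebraMap (AlgebraicClosure K)
      (Polynomial (FractionRing (Polynomial (AlgebraicClosure K))))) = Polynomial.C.comp a := by
    rw [haa]; rfl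
  rw [hc]
  generalize (Polynomial.C.comp a).comp (algebraMap K (AlgebraicClosure K)) = j
  have := hom_eval₂ F (algebraMap K (MvPolynomial (Fin 2) K))
    (eval₂Hom j ![Polynomial.X, Polynomial.C (a (algebraMap K _ α) * u⁻¹ + a (algebraMap K _ β)) +
      Polynomial.C u⁻¹ * Polynomial.X]) ![1, X 0, X 1]
  rw [coe_eval₂Hom] at this
  rw [this]
  congr 1
  · ext x
    simp [MvPolynomial.algebraMap_eq]
  · funext i
    fin_cases i
    · simp
    · simp
    · refine (eval₂Hom_X' _ _ _).trans ?_
      exact congrArg (_ + ·) (mul_comm _ _)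

lemma aux_char {K L : Type*} [Field K] [Field L] [Algebra K L] (p : ℕ) [CharP K p] {d : ℕ}
    (hd : 2 ≤ d) (hp : ¬ p ∣ d * (d - 1)) : (2 : L) ≠ 0 ∧ ((d - 1 : ℕ) : L) ≠ 0 := by
  have : CharP L p := charP_of_injective_algebraMap (algebraMap K L).injective p
  constructor
  · intro h
    apply hp
    have h2 : p ∣ 2 := (CharP.cast_eq_zero_iff L p 2).mp (by exact_mod_cast h)
    refine h2.trans ?_
    rw [← even_iff_two_dvd]
    exact Nat.even_mul_pred_self d
  · intro h
    exact hp (((CharP.cast_eq_zero_iff L p (d - 1)).mp h).mul_left d)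

/-- if `K` is an infinite field of characteristic `p` and
`f₁, …, f_r ∈ K[T,X]` are pairwise non-associate absolutely irreducible polynomials
with total degrees `d_i ≥ 2`, `p ∤ d_i(d_i − 1)` and smooth homogenizations, then there
exist `α, β ∈ K` such that for each `i` the polynomial
`g_i(U,T) = U^{d_i}·f_i(T, (α + T + β·U)/U)` has coefficients in `K[U]`, and its
splitting field over `K̄(U)` has Galois group isomorphic to `S_{d_i}`. -/
theorem exists_lineSubU_gal_symmGroup (K : Type*) [Field K] [Infinite K] (p : ℕ)
    [CharP K p] (r : ℕ) (f : Fin r → MvPolynomial (Fin 2) K) (d : Fin r → ℕ)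
    (hdeg : ∀ i, (f i).totalDegree = d i)
    (hd2 : ∀ i, 2 ≤ d i)
    (hp : ∀ i, ¬ (p ∣ d i * (d i - 1)))
    (hirr : ∀ i, AbsolutelyIrreducible (f i))
    (hassoc : ∀ i j, i ≠ j → ∀ c : K, f i ≠ c • f j)
    (hsm : ∀ i, ∃ F : MvPolynomial (Fin 3) K, IsSmoothHomogenization F (f i) (d i)) :
    ∃ α β : K, ∀ i,
      (∀ k : ℕ, ∃ c : Polynomial K,
        (lineSubU (f i) (d i) α β).coeff k =
          algebraMap (Polynomial (AlgebraicClosure K))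
            (FractionRing (Polynomial (AlgebraicClosure K)))
            (c.map (algebraMap K (AlgebraicClosure K)))) ∧
      Nonempty ((lineSubU (f i) (d i) α β).Gal ≃* Equiv.Perm (Fin (d i))) := by
  choose F hF using hsm
  let ι := algebraMap K (AlgebraicClosure K)
  have hι : Function.Injective ι := ι.injective
  have hdehom : ∀ i, (aeval ![1, X 0, X 1] ((F i).map ι) :
      MvPolynomial (Fin 2) (AlgebraicClosure K)) = (f i).map ι := by
    intro i
    rw [← (hF i).2.1, aeval_def, eval₂_map, aeval_def]
    have := hom_eval₂ (F i) (algebraMap K (MvPolynomial (Fin 2) K)) (MvPolynomial.map ι)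
      ![1, X 0, X 1]
    rw [this]
    congr 1
    · ext x
      simp [MvPolynomial.algebraMap_eq]
    · funext i
      fin_cases i <;> simp
  have hFd : ∀ i, (aeval ![1, X 0, X 1] ((F i).map ι) :
      MvPolynomial (Fin 2) (AlgebraicClosure K)).totalDegree = d i := by
    intro i
    rw [hdehom, aux_totalDegree_map _ hι, hdeg]
  have hB : ∀ i, ∃ B : MvPolynomial (Fin 2) (AlgebraicClosure K), B ≠ 0 ∧
      ∀ α β, eval ![α, β] B ≠ 0 → GoodPair ((F i).map ι) α β := by
    intro i
    obtain ⟨h2, hd1⟩ := aux_char (K := K) (L := AlgebraicClosure K) p (hd2 i) (hp i)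
    refine aux_exists_B (hd2 i) h2 hd1 ((hF i).1.map ι) ?_ (hFd i) ?_
    · intro x hx h0
      obtain ⟨j, hj⟩ := (hF i).2.2 x hx h0
      refine ⟨j, ?_⟩
      rw [pderiv_map]
      exact hj
    · rw [hdehom]
      exact hirr i
  choose B hB0 hBg using hB
  have hprod : (∏ i, B i) ≠ 0 := Finset.prod_ne_zero_iff.mpr fun i _ => hB0 i
  obtain ⟨x, hxK, hx⟩ : ∃ x : Fin 2 → AlgebraicClosure K,
      (∀ i, x i ∈ Set.range ι) ∧ eval x (∏ i, B i) ≠ 0 := by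
    by_contra hcon
    push Not at hcon
    apply hprod
    refine funext_set (fun _ => Set.range ι) (fun _ => Set.infinite_range_of_injective hι) ?_
    intro x hx
    rw [map_zero]
    exact hcon x fun i => hx i (Set.mem_univ i)
  obtain ⟨α, hα⟩ := hxK 0
  obtain ⟨β, hβ⟩ := hxK 1
  have hxe : x = ![ι α, ι β] := by
    funext i
    fin_cases i
    · exact hα.symm
    · exact hβ.symm
  rw [hxe, map_prod, Finset.prod_ne_zero_iff] at hx
  refine ⟨α, β, fun i => ⟨aux_range_coeff _ _ (hdeg i) α β, ?_⟩⟩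
  have hgood := hBg i _ _ (hx i (Finset.mem_univ i))
  exact aux_to_galois ((F i).map ι) (ι α) (ι β) hgood ((hF i).1.map ι)
    (aux_top (by have := hd2 i; omega) ((hF i).1.map ι) (hFd i)) _ rfl _ rfl _
    (aux_lineSubU_eq (f i) (d i) (F i) (hF i).2.1 α β _ rfl _ rfl)
end

section
/- Let G_1, ..., G_r be finite groups with |G_i| = d_i, and for each i let θ_i : G_i → Sym(G_i) be the left regular representation, i.e., θ_i(σ)(x) = σ·x. Let θ : G_1 × ⋯ × G_r → Sym(G_1) × ⋯ × Sym(G_r) be the product homomorphism θ(σ_1, ..., σ_r) = (θ_1(σ_1), ..., θ_r(σ_r)). Then the orbit of θ under the conjugation action of the group Sym(G_1) × ⋯ × Sym(G_r) (where τ acts on θ by (^τθ)(σ) = τ·θ(σ)·τ^{-1}) has exactly ∏_{i=1}^r (d_i − 1)! elements. -/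
/-- The orbit, under conjugation by `Sym(G₁) × ⋯ × Sym(G_r)`, of the
product of the left regular representations of finite groups `G₁, …, G_r` with
`|G_i| = d_i` has exactly `∏ (d_i − 1)!` elements. -/
theorem regular_rep_orbit_card (r : ℕ) (G : Fin r → Type*) [∀ i, Group (G i)]
    [∀ i, Fintype (G i)] (d : Fin r → ℕ) (hd : ∀ i, Fintype.card (G i) = d i)
    (θ : ((i : Fin r) → G i) →* ((i : Fin r) → Equiv.Perm (G i)))
    (hθ : ∀ (σ : (i : Fin r) → G i) (i : Fin r) (x : G i), θ σ i x = σ i * x) :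
    Nat.card {θ' : ((i : Fin r) → G i) →* ((i : Fin r) → Equiv.Perm (G i)) //
        ∃ τ : (i : Fin r) → Equiv.Perm (G i), ∀ σ, θ' σ = τ * θ σ * τ⁻¹} =
      ∏ i, Nat.factorial (d i - 1) := by
  classical
  let O := {θ' : ((i : Fin r) → G i) →* ((i : Fin r) → Equiv.Perm (G i)) //
        ∃ τ : (i : Fin r) → Equiv.Perm (G i), ∀ σ, θ' σ = τ * θ σ * τ⁻¹}
  -- `τ ↦ (^τθ, (τ_i 1)_i)` is a bijection
  let f : ((i : Fin r) → Equiv.Perm (G i)) → O × ((i : Fin r) → G i) := fun τ =>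
    (⟨(MulAut.conj τ).toMonoidHom.comp θ, τ, fun σ => rfl⟩, fun i => τ i 1)
  have hf : Function.Bijective f := by
    constructor
    · intro τ ρ h
      have h1 : (MulAut.conj τ).toMonoidHom.comp θ = (MulAut.conj ρ).toMonoidHom.comp θ :=
        congrArg (fun p => p.1.1) h
      have h2 : ∀ i, τ i 1 = ρ i 1 := fun i => congrFun (congrArg Prod.snd h) i
      funext i
      ext x
      have h3 : τ * θ (Pi.mulSingle i x) * τ⁻¹ = ρ * θ (Pi.mulSingle i x) * ρ⁻¹ :=
        DFunLike.congr_fun h1 (Pi.mulSingle i x)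
      have h4 : ∀ κ : (i : Fin r) → Equiv.Perm (G i),
          (κ * θ (Pi.mulSingle i x) * κ⁻¹) i (κ i 1) = κ i x := by
        intro κ
        simp [hθ]
      rw [← h4 τ, ← h4 ρ, h3, h2]
    · rintro ⟨⟨θ', τ, hτ⟩, y⟩
      refine ⟨fun i => τ i * Equiv.mulRight ((τ i).symm (y i)), ?_⟩
      refine Prod.ext (Subtype.ext (MonoidHom.ext fun σ => ?_)) ?_
      · rw [hτ]
        funext i
        change (τ i * Equiv.mulRight _) * θ σ i * (τ i * Equiv.mulRight _)⁻¹ = τ i * θ σ i * (τ i)⁻¹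
        rw [mul_inv_eq_iff_eq_mul]
        ext x
        simp [hθ, mul_assoc]
      · funext i
        simp [f]
  have hc := Nat.card_congr (Equiv.ofBijective f hf)
  rw [Nat.card_prod, Nat.card_pi, Nat.card_pi] at hc
  have hpos : ∀ i, 0 < d i := fun i => hd i ▸ Fintype.card_pos
  have e1 : ∀ i, Nat.card (Equiv.Perm (G i)) = (d i - 1).factorial * d i := by
    intro i
    rw [Nat.card_eq_fintype_card, Fintype.card_perm, hd, mul_comm,
      Nat.mul_factorial_pred (hpos i).ne']
  have e2 : ∀ i, Nat.card (G i) = d i := fun i => by rw [Nat.card_eq_fintype_card, hd]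
  simp only [e1, e2, Finset.prod_mul_distrib] at hc
  exact (Nat.eq_of_mul_eq_mul_right (Finset.prod_pos fun i _ => hpos i) hc).symm
end

section
/- Let N/E be a finite Galois extension of fields, and let F and M be intermediate fields of N/E such that F/E and M/E are Galois, the compositum F·M equals N, and F ∩ M = E. Let θ̄ : Gal(M/E) → Gal(F/E) be an isomorphism of groups. Let Δ = {δ ∈ Gal(N/E) : θ̄(δ|_M) = δ|_F}, where δ|_M ∈ Gal(M/E) and δ|_F ∈ Gal(F/E) denote the restrictions of δ. Then Δ is a subgroup of Gal(N/E), and its fixed field F' = N^Δ satisfies: F·F' = N, F'·M = N, F ∩ F' = E, and F' ∩ M = E. -/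
open IntermediateField

theorem fca_inf {E N : Type*} [Field E] [Field N] [Algebra E N]
    [FiniteDimensional E N] [IsGalois E N] (K : IntermediateField E N)
    (D : Subgroup (N ≃ₐ[E] N)) (h : K.fixingSubgroup ⊔ D = ⊤) :
    K ⊓ fixedField D = ⊥ := by
  have h1 : K.fixingSubgroup ≤ (K ⊓ fixedField D).fixingSubgroup :=
    fixingSubgroup_antitone inf_le_left
  have h2 : D ≤ (K ⊓ fixedField D).fixingSubgroup :=
    (fixingSubgroup_fixedField D).ge.trans (fixingSubgroup_antitone inf_le_right)
  have h3 : (K ⊓ fixedField D).fixingSubgroup = ⊤ := by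
    rw [eq_top_iff, ← h]; exact sup_le h1 h2
  rw [← IsGalois.fixedField_fixingSubgroup (K ⊓ fixedField D), h3, IsGalois.fixedField_top]

theorem fca_sup {E N : Type*} [Field E] [Field N] [Algebra E N]
    [FiniteDimensional E N] [IsGalois E N] (K : IntermediateField E N)
    (D : Subgroup (N ≃ₐ[E] N)) (h : K.fixingSubgroup ⊓ D = ⊥) :
    K ⊔ fixedField D = ⊤ := by
  rw [← IsGalois.fixedField_fixingSubgroup (K ⊔ fixedField D), fixingSubgroup_sup,
    fixingSubgroup_fixedField, h, fixedField_bot]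

theorem fca_top {E N : Type*} [Field E] [Field N] [Algebra E N]
    [FiniteDimensional E N] [IsGalois E N] (F M : IntermediateField E N) (h : F ⊓ M = ⊥) :
    F.fixingSubgroup ⊔ M.fixingSubgroup = ⊤ := by
  have h1 : fixedField (F.fixingSubgroup ⊔ M.fixingSubgroup) ≤ F ⊓ M := by
    refine le_inf ?_ ?_
    · exact (fixedField_antitone le_sup_left).trans (IsGalois.fixedField_fixingSubgroup F).le
    · exact (fixedField_antitone le_sup_right).trans (IsGalois.fixedField_fixingSubgroup M).le
  rw [h, le_bot_iff] at h1
  rw [← fixingSubgroup_fixedField (F.fixingSubgroup ⊔ M.fixingSubgroup), h1, fixingSubgroup_bot]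

/-- the field crossing argument.  Let `N/E` be a finite Galois extension,
`F`, `M` intermediate fields Galois over `E` with `F ⊔ M = N` and `F ⊓ M = E`, and let
`θ̄ : Gal(M/E) ≃ Gal(F/E)` be an isomorphism.  Then
`Δ = {δ ∈ Gal(N/E) : θ̄(δ|_M) = δ|_F}` is a subgroup of `Gal(N/E)` whose fixed field
`F'` satisfies `F·F' = N`, `F'·M = N`, `F ∩ F' = E` and `F' ∩ M = E`. -/
theorem field_crossing_argument (E N : Type*) [Field E] [Field N] [Algebra E N]
    [FiniteDimensional E N] [IsGalois E N]
    (F M : IntermediateField E N) [IsGalois E F] [IsGalois E M]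
    (hFM : F ⊔ M = ⊤) (hFM' : F ⊓ M = ⊥)
    (θbar : (M ≃ₐ[E] M) ≃* (F ≃ₐ[E] F)) :
    ∃ Δ : Subgroup (N ≃ₐ[E] N),
      (∀ δ : N ≃ₐ[E] N, δ ∈ Δ ↔
        θbar (AlgEquiv.restrictNormalHom M δ) = AlgEquiv.restrictNormalHom F δ) ∧
      F ⊔ IntermediateField.fixedField Δ = ⊤ ∧
      IntermediateField.fixedField Δ ⊔ M = ⊤ ∧
      F ⊓ IntermediateField.fixedField Δ = ⊥ ∧
      IntermediateField.fixedField Δ ⊓ M = ⊥ := by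
  have hA := F.restrictNormalHom_ker
  have hB := M.restrictNormalHom_ker
  have hbot : F.fixingSubgroup ⊓ M.fixingSubgroup = ⊥ := by
    rw [← fixingSubgroup_sup, hFM, fixingSubgroup_top]
  have htop := fca_top F M hFM'
  have hsM := AlgEquiv.restrictNormalHom_surjective (F := E) (K₁ := M) N
  have hsF := AlgEquiv.restrictNormalHom_surjective (F := E) (K₁ := F) N
  rw [← hA, ← hB] at hbot htop
  generalize hrF : (AlgEquiv.restrictNormalHom F : (N ≃ₐ[E] N) →* (F ≃ₐ[E] F)) = rF at *
  generalize hrM : (AlgEquiv.restrictNormalHom M : (N ≃ₐ[E] N) →* (M ≃ₐ[E] M)) = rM at *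
  have pair : ∀ (u : M ≃ₐ[E] M) (v : F ≃ₐ[E] F), ∃ δ, rM δ = u ∧ rF δ = v := by
    intro u v
    obtain ⟨g, rfl⟩ := hsM u
    obtain ⟨h, rfl⟩ := hsF v
    have hm : h⁻¹ * g ∈ rF.ker ⊔ rM.ker := htop ▸ Subgroup.mem_top _
    obtain ⟨a, ha, b, hb, hab⟩ := Subgroup.mem_sup_of_normal_right.1 hm
    rw [MonoidHom.mem_ker] at ha hb
    refine ⟨h * a, ?_, by simp [ha]⟩
    have : g = h * a * b := by rw [mul_assoc, hab]; group
    rw [this, map_mul _ _ b, hb, mul_one]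
  let D : Subgroup (N ≃ₐ[E] N) := (θbar.toMonoidHom.comp rM).eqLocus rF
  have hD : ∀ δ, δ ∈ D ↔ θbar (rM δ) = rF δ := fun δ => Iff.rfl
  have split : ∀ (A : Subgroup (N ≃ₐ[E] N)), (∀ g, ∃ δ ∈ D, g * δ⁻¹ ∈ A) → A ⊔ D = ⊤ := by
    intro A h
    rw [eq_top_iff]
    intro g _
    obtain ⟨δ, hδ, hg⟩ := h g
    have := Subgroup.mul_mem_sup hg hδ
    simpa using this
  have e1 : rF.ker ⊓ D = ⊥ := by
    rw [eq_bot_iff, ← hbot]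
    rintro δ ⟨h1, h2⟩
    refine ⟨h1, ?_⟩
    have h1' : rF δ = 1 := h1
    have h2' := (hD δ).1 h2
    rw [h1'] at h2'
    exact (MulEquiv.map_eq_one_iff θbar).1 h2'
  have e2 : rM.ker ⊓ D = ⊥ := by
    rw [eq_bot_iff, ← hbot]
    rintro δ ⟨h1, h2⟩
    refine ⟨?_, h1⟩
    have h1' : rM δ = 1 := h1
    have h2' := (hD δ).1 h2
    rw [h1', map_one] at h2'
    exact h2'.symm
  have e3 : rF.ker ⊔ D = ⊤ := by
    refine split _ fun g => ?_
    obtain ⟨δ, h1, h2⟩ := pair (θbar.symm (rF g)) (rF g)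
    exact ⟨δ, by rw [hD, h1, h2]; simp, by simp [MonoidHom.mem_ker, h2]⟩
  have e4 : rM.ker ⊔ D = ⊤ := by
    refine split _ fun g => ?_
    obtain ⟨δ, h1, h2⟩ := pair (rM g) (θbar (rM g))
    exact ⟨δ, by rw [hD, h1, h2], by simp [MonoidHom.mem_ker, h1]⟩
  rw [hA] at e1 e3
  rw [hB] at e2 e4
  refine ⟨D, hD, fca_sup F D e1, ?_, fca_inf F D e3, ?_⟩
  · rw [sup_comm]; exact fca_sup M D e2
  · rw [inf_comm]; exact fca_inf M D e4
end

section
/- Let K be a field, let n ≥ 1, let E = K(A_1, ..., A_n) be the field of rational functions in n variables over K, fix a separable closure E_s of E, and let t_1, ..., t_r ∈ E_s be elements such that for each i there is a separable polynomial f_i ∈ E[T] with f_i(t_i) = 0. Then there exist a nonzero polynomial g ∈ K[A_1, ..., A_n] and an element t ∈ E_s such that: (1) E(t) = E(t_1, ..., t_r); (2) t is integral over the ring R = K[A_1, ..., A_n][1/g]; (3) S = R[t] is the integral closure of R in E(t), and S is a finite étale R-algebra; and (4) for each i, after multiplying f_i by a suitable nonzero element of E one may assume f_i is monic with coefficients in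 R, and R[T]/(f_i) is an étale R-algebra (equivalently, the discriminant of f_i is a unit of R). -/
open MvPolynomial

theorem etale_adjoinRoot_of_separable {R : Type*} [CommRing R] (p : Polynomial R)
    (hm : p.Monic) (hs : p.Separable) : Algebra.Etale R (AdjoinRoot p) := by
  obtain ⟨a, b, hab⟩ := hs
  let Q : StandardEtalePair R := ⟨p, hm, 1, b, a, 0, by simp only [pow_zero]; linear_combination hab⟩
  have h1 : Q.HasMap (AdjoinRoot.root p) := ⟨by simp [Q], by simp [Q]⟩
  have h2 : p.eval₂ (Algebra.ofId R Q.Ring) Q.X = 0 := (StandardEtalePair.hasMap_X (P := Q)).1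
  have h3 := AdjoinRoot.liftAlgHom_root p (Algebra.ofId R Q.Ring) Q.X h2
  let e : Q.Ring ≃ₐ[R] AdjoinRoot p :=
    AlgEquiv.ofAlgHom (Q.lift _ h1)
      (AdjoinRoot.liftAlgHom p (Algebra.ofId R Q.Ring) Q.X h2)
      (by ext; simp [h3]) (by ext; simp [h3])
  exact Algebra.Etale.of_equiv e

theorem exists_separable_lift {R E : Type*} [CommRing R] [Field E] [Algebra R E]
    (hinj : Function.Injective (algebraMap R E)) (q a b : Polynomial E) (hm : q.Monic)
    (hab : a * q + b * q.derivative = 1)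
    (hq : q ∈ Polynomial.lifts (algebraMap R E)) (ha : a ∈ Polynomial.lifts (algebraMap R E))
    (hb : b ∈ Polynomial.lifts (algebraMap R E)) :
    ∃ p : Polynomial R, p.Monic ∧ p.Separable ∧ p.map (algebraMap R E) = q := by
  obtain ⟨p, hp, -, hpm⟩ := Polynomial.lifts_and_natDegree_eq_and_monic hq hm
  obtain ⟨a', rfl⟩ := (Polynomial.lifts_iff_set_range _).1 ha
  obtain ⟨b', rfl⟩ := (Polynomial.lifts_iff_set_range _).1 hb
  refine ⟨p, hpm, ⟨a', b', ?_⟩, hp⟩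
  apply Polynomial.map_injective _ hinj
  subst hp
  simpa [Polynomial.derivative_map] using hab

theorem mem_adjoin_of_isIntegral {R E F : Type*} [CommRing R] [IsDomain R] [IsIntegrallyClosed R]
    [Field E] [Field F] [Algebra R E] [IsFractionRing R E] [Algebra E F] [Algebra R F]
    [IsScalarTower R E F] [FiniteDimensional E F] [Algebra.IsSeparable E F]
    (t : F) (ht : IsIntegral R t) (htop : Algebra.adjoin E {t} = ⊤)
    (hs : (minpoly R t).Separable) (x : F) (hx : IsIntegral R x) :
    x ∈ Algebra.adjoin R {t} := by
  have h := traceForm_dualSubmodule_adjoin R E htop ht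
  have h1 : x ∈ (Algebra.traceForm E F).dualSubmodule
      (Subalgebra.toSubmodule (Algebra.adjoin R {t})) := by
    rw [LinearMap.BilinForm.mem_dualSubmodule]
    intro y hy
    have hy' : IsIntegral R y := by
      have := Algebra.IsIntegral.adjoin (R := R) (A := F) (S := {t}) (by simpa using ht)
      have := this.isIntegral ⟨y, hy⟩
      exact this.map (Subalgebra.val _)
    rw [Algebra.traceForm_apply, Submodule.mem_one]
    exact IsIntegrallyClosed.isIntegral_iff.1 (Algebra.isIntegral_trace (hx.mul hy'))
  rw [h] at h1
  obtain ⟨y, hy, hyx⟩ := h1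
  obtain ⟨a, b, hab⟩ := hs
  have h2 := congrArg (Polynomial.aeval t) hab
  simp only [map_add, map_mul, minpoly.aeval, mul_zero, zero_add, map_one] at h2
  have h3 : Polynomial.aeval t (Polynomial.derivative (minpoly E t)) =
      Polynomial.aeval t (Polynomial.derivative (minpoly R t)) := by
    rw [minpoly.isIntegrallyClosed_eq_field_fractions' E ht, Polynomial.derivative_map,
      Polynomial.aeval_map_algebraMap]
  rw [← hyx]
  simp only [h3, DistribSMul.toLinearMap_apply, smul_eq_mul]
  rw [← eq_inv_of_mul_eq_one_left h2]
  exact mul_mem (Polynomial.aeval_mem_adjoin_singleton _ _) hy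

theorem core_cover {R E L : Type*} [CommRing R] [IsDomain R] [IsIntegrallyClosed R]
    [Field E] [Field L] [Algebra R E] [IsFractionRing R E] [Algebra E L] [Algebra R L]
    [IsScalarTower R E L] (t : L) (p : Polynomial R) (hm : p.Monic) (hs : p.Separable)
    (hp : p.map (algebraMap R E) = minpoly E t) (hti : IsSeparable E t) :
    IsIntegral R t ∧
    (∀ x, x ∈ Algebra.adjoin R {t} ↔ x ∈ IntermediateField.adjoin E {t} ∧ IsIntegral R x) ∧
    Module.Finite R (Algebra.adjoin R {t}) ∧ Algebra.Etale R (Algebra.adjoin R {t}) := by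
  have ht : IsIntegral R t := by
    refine ⟨p, hm, ?_⟩
    have := minpoly.aeval E t
    rwa [← hp, Polynomial.aeval_map_algebraMap] at this
  have : Module.IsTorsionFree R L := by
    have : FaithfulSMul R L := by
      rw [faithfulSMul_iff_algebraMap_injective, IsScalarTower.algebraMap_eq R E L]
      exact (algebraMap E L).injective.comp (IsFractionRing.injective R E)
    infer_instance
  have hpe : p = minpoly R t := by
    apply Polynomial.map_injective _ (IsFractionRing.injective R E)
    rw [hp, minpoly.isIntegrallyClosed_eq_field_fractions' E ht]
  have hint : Algebra.IsIntegral R (Algebra.adjoin R {t}) :=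
    Algebra.IsIntegral.adjoin (R := R) (A := L) (S := {t}) (by simpa using ht)
  refine ⟨ht, fun x => ⟨fun hx => ⟨?_, ?_⟩, ?_⟩, Algebra.finite_adjoin_simple_of_isIntegral ht, ?_⟩
  · have : Algebra.adjoin R {t} ≤
      (IntermediateField.adjoin E {t}).toSubalgebra.restrictScalars R := by
      rw [Algebra.adjoin_le_iff]
      simp
    exact this hx
  · exact (hint.isIntegral ⟨x, hx⟩).map (Subalgebra.val _)
  · rintro ⟨hx, hxi⟩
    let F := IntermediateField.adjoin E {t}
    have hE : IsIntegral E t := ht.tower_top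
    have : FiniteDimensional E F := IntermediateField.adjoin.finiteDimensional hE
    have : Algebra.IsSeparable E F :=
      (IntermediateField.isSeparable_adjoin_simple_iff_isSeparable E L).2 hti
    let t' : F := IntermediateField.AdjoinSimple.gen E t
    have htop : Algebra.adjoin E {t'} = ⊤ := by
      have := (IntermediateField.adjoin.powerBasis hE).adjoin_gen_eq_top
      simpa using this
    let ι : F →ₐ[R] L := (F.val).restrictScalars R
    have hι : Function.Injective ι := F.val.injective
    have hmem := mem_adjoin_of_isIntegral (R := R) (E := E) t'
      ((isIntegral_algHom_iff ι hι).1 ht) htop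
      (by rw [← minpoly.algHom_eq ι hι]; exact hpe ▸ hs) ⟨x, hx⟩
      ((isIntegral_algHom_iff ι hι).1 hxi)
    have h2 : ι ⟨x, hx⟩ ∈ (Algebra.adjoin R {t'}).map ι := ⟨_, hmem, rfl⟩
    rw [AlgHom.map_adjoin, Set.image_singleton] at h2
    exact h2
  · have := etale_adjoinRoot_of_separable p hm hs
    rw [hpe] at this
    exact Algebra.Etale.of_equiv (minpoly.equivAdjoin ht)

theorem isLocalization_closure {P L : Type*} [CommRing P] [Field L] (φ : P →+* L)
    (hφ : Function.Injective φ) (g : P) (hg : g ≠ 0) (R : Subring L)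
    (hR : R = Subring.closure (Set.range φ ∪ {(φ g)⁻¹})) [Algebra P R]
    (hA : ∀ x : P, ((algebraMap P R x : R) : L) = φ x) : IsLocalization.Away g R := by
  have hg' : φ g ≠ 0 := by rwa [Ne, map_eq_zero_iff φ hφ]
  have hmem : (φ g)⁻¹ ∈ R := by rw [hR]; exact Subring.subset_closure (Or.inr rfl)
  have key : ∀ x ∈ R, ∃ (m : ℕ) (a : P), x * φ g ^ m = φ a := by
    intro x hx
    rw [hR] at hx
    induction hx using Subring.closure_induction with
    | mem x hx =>
      rcases hx with ⟨a, rfl⟩ | hx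
      · exact ⟨0, a, by simp⟩
      · rw [Set.mem_singleton_iff] at hx
        exact ⟨1, 1, by simp [hx, hg']⟩
    | zero => exact ⟨0, 0, by simp⟩
    | one => exact ⟨0, 1, by simp⟩
    | add x y _ _ hx hy =>
      obtain ⟨m, a, h1⟩ := hx
      obtain ⟨k, b, h2⟩ := hy
      refine ⟨m + k, a * g ^ k + b * g ^ m, ?_⟩
      simp only [map_add, map_mul, map_pow, ← h1, ← h2]
      ring
    | neg x _ hx =>
      obtain ⟨m, a, h1⟩ := hx
      exact ⟨m, -a, by simp [← h1]⟩
    | mul x y _ _ hx hy =>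
      obtain ⟨m, a, h1⟩ := hx
      obtain ⟨k, b, h2⟩ := hy
      refine ⟨m + k, a * b, ?_⟩
      simp only [map_mul, ← h1, ← h2]
      ring
  refine ⟨?_, ?_, ?_⟩
  · rintro ⟨_, k, rfl⟩
    simp only [map_pow]
    apply IsUnit.pow
    refine IsUnit.of_mul_eq_one ⟨_, hmem⟩ (Subtype.ext ?_)
    simp [hA, hg']
  · intro x
    obtain ⟨m, a, h⟩ := key x x.2
    exact ⟨(a, ⟨g ^ m, m, rfl⟩), Subtype.ext (by simpa [hA] using h)⟩
  · intro x y hxy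
    refine ⟨1, ?_⟩
    have := congrArg (Subtype.val) hxy
    rw [hA, hA] at this
    rw [hφ this]

/-- the paper's Lemma 2.6, without the effectivity clause.
Let `E = K(A₁,…,A_n)` be a rational function field, `E_s` a separable closure of `E`,
and `t₁,…,t_r ∈ E_s` roots of separable polynomials `f₁,…,f_r ∈ E[T]`.  Then there are
a nonzero `g ∈ K[A₁,…,A_n]` and `t ∈ E_s` such that, with `R` the subring
`K[A₁,…,A_n][1/g]` of `E_s` and `S = R[t]`:
(1) `E(t) = E(t₁,…,t_r)`;
(2) `t` is integral over `R`;
(3) `S` is the integral closure of `R` in `E(t)` and is a finite étale `R`-algebra;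
(4) each `f_i` becomes, after multiplication by a suitable nonzero `c ∈ E`, a monic
polynomial `fR` with coefficients in `R` such that `R[T]/(fR)` is an étale
`R`-algebra. -/
theorem exists_ring_cover (K : Type*) [Field K] (n : ℕ) (hn : 1 ≤ n)
    (Es : Type*) [Field Es]
    [Algebra (FractionRing (MvPolynomial (Fin n) K)) Es]
    [IsSepClosure (FractionRing (MvPolynomial (Fin n) K)) Es]
    (r : ℕ) (ts : Fin r → Es)
    (f : Fin r → Polynomial (FractionRing (MvPolynomial (Fin n) K)))
    (hsep : ∀ i, (f i).Separable)
    (hroot : ∀ i, Polynomial.aeval (ts i) (f i) = 0) :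
    ∃ (g : MvPolynomial (Fin n) K) (t : Es), g ≠ 0 ∧
      -- `φ` embeds `K[A₁,…,A_n]` into `E_s`; `R = K[A₁,…,A_n][1/g]`, `S = R[t]`.
      (let E := FractionRing (MvPolynomial (Fin n) K)
       let φ : MvPolynomial (Fin n) K →+* Es :=
         (algebraMap E Es).comp (algebraMap (MvPolynomial (Fin n) K) E)
       let R : Subring Es := Subring.closure (Set.range φ ∪ {(φ g)⁻¹})
       let S : Subring Es := Subring.closure ((R : Set Es) ∪ {t})
       -- (1) `E(t) = E(t₁,…,t_r)`
       IntermediateField.adjoin E {t} = IntermediateField.adjoin E (Set.range ts) ∧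
       -- (2) `t` is integral over `R`
       R.subtype.IsIntegralElem t ∧
       -- (3) `S` is the integral closure of `R` in `E(t)` ...
       ((S : Set Es) =
          {x : Es | x ∈ IntermediateField.adjoin E {t} ∧ R.subtype.IsIntegralElem x}) ∧
       -- ... and `S` is a finite étale `R`-algebra
       (∃ hle : R ≤ S,
         let _ : Algebra R S := (Subring.inclusion hle).toAlgebra
         Module.Finite R S ∧ Algebra.Etale R S) ∧
       -- (4) each `f_i`, scaled by a nonzero `c ∈ E`, is monic with coefficients in
       -- `R` and `R[T]/(f_i)` is étale over `R`
       (∀ i, ∃ c : E, c ≠ 0 ∧ ∃ fR : Polynomial R, fR.Monic ∧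
          fR.map R.subtype = (c • f i).map (algebraMap E Es) ∧
          Algebra.Etale R (AdjoinRoot fR))) := by
  classical
  have hsepEs : Algebra.IsSeparable (FractionRing (MvPolynomial (Fin n) K)) Es :=
    IsSepClosure.separable
  -- primitive element
  obtain ⟨t, ht⟩ : ∃ t : Es,
      IntermediateField.adjoin (FractionRing (MvPolynomial (Fin n) K)) {t} =
      IntermediateField.adjoin (FractionRing (MvPolynomial (Fin n) K)) (Set.range ts) := by
    set F := IntermediateField.adjoin (FractionRing (MvPolynomial (Fin n) K)) (Set.range ts)
    have : FiniteDimensional (FractionRing (MvPolynomial (Fin n) K)) F :=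
      IntermediateField.finiteDimensional_adjoin
        fun x _ => Algebra.IsIntegral.isIntegral x
    obtain ⟨α, hα⟩ := Field.exists_primitive_element (FractionRing (MvPolynomial (Fin n) K)) F
    refine ⟨α, ?_⟩
    have := congrArg IntermediateField.lift hα
    rwa [IntermediateField.lift_adjoin_simple, IntermediateField.lift_top] at this
  have hts : IsSeparable (FractionRing (MvPolynomial (Fin n) K)) t :=
    Algebra.IsSeparable.isSeparable _ t
  have hf0 : ∀ i, (f i).leadingCoeff ≠ 0 := fun i =>
    Polynomial.leadingCoeff_ne_zero.2 (hsep i).ne_zero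
  -- the family of monic separable polynomials
  let q : Option (Fin r) → Polynomial (FractionRing (MvPolynomial (Fin n) K)) := fun o =>
    o.elim (minpoly _ t) (fun i => (f i).leadingCoeff⁻¹ • f i)
  have hqm : ∀ o, (q o).Monic := by
    rintro (_ | i)
    · exact minpoly.monic (Algebra.IsIntegral.isIntegral t)
    · simp only [q, Option.elim]
      rw [Polynomial.Monic, Polynomial.smul_eq_C_mul, Polynomial.leadingCoeff_mul,
        Polynomial.leadingCoeff_C, inv_mul_cancel₀ (hf0 i)]
  have hqs : ∀ o, (q o).Separable := by
    rintro (_ | i)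
    · exact hts
    · simp only [q, Option.elim, Polynomial.smul_eq_C_mul]
      exact (hsep i).unit_mul (Polynomial.isUnit_C.2 (inv_ne_zero (hf0 i)).isUnit)
  choose a b hab using hqs
  obtain ⟨⟨g, hg⟩, hgs⟩ := IsLocalization.exist_integer_multiples_of_finset
    (nonZeroDivisors (MvPolynomial (Fin n) K))
    (Finset.univ.biUnion fun o => (q o).coeffs ∪ (a o).coeffs ∪ (b o).coeffs)
  have hg0 : g ≠ 0 := nonZeroDivisors.ne_zero hg
  refine ⟨g, t, hg0, ?_⟩
  intro E φ R S
  have hφ : Function.Injective φ :=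
    (algebraMap E Es).injective.comp (IsFractionRing.injective _ E)
  have hφR : ∀ x, φ x ∈ R := fun x => Subring.subset_closure (Or.inl ⟨x, rfl⟩)
  let _ : Algebra (MvPolynomial (Fin n) K) R := (φ.codRestrict R hφR).toAlgebra
  have hA : ∀ x, ((algebraMap (MvPolynomial (Fin n) K) R x : R) : Es) = φ x := fun _ => rfl
  have hloc : IsLocalization.Away g R := isLocalization_closure φ hφ g hg0 R rfl hA
  have hgE : algebraMap (MvPolynomial (Fin n) K) E g ≠ 0 := by
    rwa [Ne, map_eq_zero_iff _ (IsFractionRing.injective (MvPolynomial (Fin n) K) E)]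
  let ψ : R →+* E := IsLocalization.Away.lift (S := R) g (g := algebraMap _ E) hgE.isUnit
  let _ : Algebra R E := ψ.toAlgebra
  have hψ : ∀ x, ψ (algebraMap _ R x) = algebraMap _ E x := fun x =>
    IsLocalization.Away.lift_eq g hgE.isUnit x
  have : IsScalarTower (MvPolynomial (Fin n) K) R E :=
    IsScalarTower.of_algebraMap_eq fun x => (hψ x).symm
  have hcomp : (algebraMap E Es).comp ψ = R.subtype := by
    apply IsLocalization.ringHom_ext (Submonoid.powers g)
    ext x <;> simp [hψ, hA, φ]
  have : IsScalarTower R E Es :=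
    IsScalarTower.of_algebraMap_eq fun x => (congrArg (fun h => h x) hcomp).symm
  have : IsFractionRing R E :=
    IsFractionRing.isFractionRing_of_isDomain_of_isLocalization (Submonoid.powers g) R E
  have : IsIntegrallyClosed R := isIntegrallyClosed_of_isLocalization R (Submonoid.powers g)
    (powers_le_nonZeroDivisors_of_noZeroDivisors hg0)
  have hrange : ∀ x : E,
      x ∈ (Finset.univ.biUnion fun o => (q o).coeffs ∪ (a o).coeffs ∪ (b o).coeffs) →
      x ∈ Set.range (algebraMap R E) := by
    intro x hx
    obtain ⟨y, hy⟩ := hgs x hx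
    refine ⟨IsLocalization.Away.invSelf g * algebraMap _ R y, ?_⟩
    have h1 := congrArg (algebraMap R E) (IsLocalization.Away.mul_invSelf (S := R) g)
    rw [map_mul, ← IsScalarTower.algebraMap_apply, map_one] at h1
    rw [map_mul, ← IsScalarTower.algebraMap_apply, hy, Algebra.smul_def, ← mul_assoc,
      mul_comm (algebraMap R E _), h1, one_mul]
  have hlift : ∀ o, ∃ p : Polynomial R, p.Monic ∧ p.Separable ∧ p.map (algebraMap R E) = q o := by
    intro o
    refine exists_separable_lift (IsFractionRing.injective R E) (q o) (a o) (b o) (hqm o) (hab o)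
      ?_ ?_ ?_ <;>
    · rw [Polynomial.lifts_iff_coeffs_subset_range]
      intro x hx
      apply hrange
      rw [Finset.mem_biUnion]
      refine ⟨o, Finset.mem_univ _, ?_⟩
      simp only [Finset.mem_union]
      simp only [Finset.mem_coe] at hx
      tauto
  choose p hpm hps hpq using hlift
  obtain ⟨h2, h3, h4, h5⟩ := core_cover (R := R) (E := E) t (p none) (hpm none) (hps none)
    (hpq none) hts
  have hSA : ∀ x, x ∈ S ↔ x ∈ Algebra.adjoin R {t} := by
    intro x
    rw [Algebra.mem_adjoin_iff]
    have : Set.range (algebraMap R Es) = (R : Set Es) := Subtype.range_coe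
    rw [this]
  have hle : R ≤ S := fun x hx => Subring.subset_closure (Or.inl hx)
  refine ⟨ht, h2, ?_, ⟨hle, ?_⟩, ?_⟩
  · ext x
    exact (hSA x).trans (h3 x)
  · intro _
    let e : Algebra.adjoin R {t} ≃ₐ[R] S :=
      { toFun := fun x => ⟨x.1, (hSA _).2 x.2⟩
        invFun := fun x => ⟨x.1, (hSA _).1 x.2⟩
        left_inv := fun _ => rfl
        right_inv := fun _ => rfl
        map_mul' := fun _ _ => rfl
        map_add' := fun _ _ => rfl
        commutes' := fun _ => rfl }
    exact ⟨Module.Finite.equiv e.toLinearEquiv, Algebra.Etale.of_equiv e⟩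
  · intro i
    refine ⟨(f i).leadingCoeff⁻¹, inv_ne_zero (hf0 i), p (some i), hpm _, ?_,
      etale_adjoinRoot_of_separable _ (hpm _) (hps _)⟩
    have := congrArg (Polynomial.map (algebraMap E Es)) (hpq (some i))
    rw [Polynomial.map_map] at this
    rw [← hcomp]
    exact this
end
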